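/- Let γ > 0 and ω > 0, and let φ : ℝ × [0,1] → ℝ be Hölder continuous with φ(t+ω, x) = φ(t, x) for all t ∈ ℝ, x ∈ [0,1]. Then the linear extended Fisher–Kolmogorov equation ∂ₜu(t,x) + γ ∂ₓ⁴u(t,x) − ∂ₓ²u(t,x) − u(t,x) = φ(t,x) on ℝ × (0,1), with boundary conditions u(t,0) = u(t,1) = 0 and ∂ₓ²u(t,0) = ∂ₓ²u(t,1) = 0 for all t ∈ ℝ, has exactly one time ω-periodic classical solution u (i.e., exactly one u that is continuous on ℝ × [0,1] with u(t+ω,x) = u(t,x), is C¹ in t and C⁴ in x on ℝ × (0,1) with ∂ₓ²u extending continuously to the boundary, and satisfies the equation and boundary conditions pointwise). -/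

import Mathlib

open Real Set Filter Topology

/-- Time partial derivative of `u : ℝ → ℝ → ℝ` (first variable = time). -/
noncomputable def dt (u : ℝ → ℝ → ℝ) (t x : ℝ) : ℝ := deriv (fun s => u s x) t

/-- `k`-th spatial partial derivative of `u : ℝ → ℝ → ℝ` (second variable = space). -/
noncomputable def dx (k : ℕ) (u : ℝ → ℝ → ℝ) (t x : ℝ) : ℝ := iteratedDeriv k (u t) x

/-- `u` is a time `ω`-periodic classical solution of the linear extended
Fisher–Kolmogorov equation `∂ₜu + γ∂ₓ⁴u − ∂ₓ²u − u = φ(t,x)` on `ℝ × (0,1)`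
with Navier boundary conditions. -/
def IsLinearPeriodicClassicalSolution (γ ω : ℝ) (φ : ℝ → ℝ → ℝ) (u : ℝ → ℝ → ℝ) : Prop :=
  ContinuousOn (fun p : ℝ × ℝ => u p.1 p.2) (univ ×ˢ Icc 0 1) ∧
  (∀ t x, u (t + ω) x = u t x) ∧
  (∀ t : ℝ, ∀ x ∈ Ioo (0:ℝ) 1, DifferentiableAt ℝ (fun s => u s x) t) ∧
  (∀ t : ℝ, ∀ x ∈ Ioo (0:ℝ) 1, ∀ k < 4, DifferentiableAt ℝ (iteratedDeriv k (u t)) x) ∧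
  ContinuousOn (fun p : ℝ × ℝ => dt u p.1 p.2) (univ ×ˢ Ioo 0 1) ∧
  (∀ k ≤ 4, ContinuousOn (fun p : ℝ × ℝ => dx k u p.1 p.2) (univ ×ˢ Ioo 0 1)) ∧
  ContinuousOn (fun p : ℝ × ℝ => dx 2 u p.1 p.2) (univ ×ˢ Icc 0 1) ∧
  (∀ t : ℝ, ∀ x ∈ Ioo (0:ℝ) 1,
    dt u t x + γ * dx 4 u t x - dx 2 u t x - u t x = φ t x) ∧
  (∀ t : ℝ, u t 0 = 0 ∧ u t 1 = 0 ∧ dx 2 u t 0 = 0 ∧ dx 2 u t 1 = 0)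

lemma integral_mul_sin_mul_cos_pow_eq_zero {g : ℝ → ℝ} (hg : ContinuousOn g (Icc 0 1))
    (h : ∀ n : ℕ, ∫ x in (0:ℝ)..1, g x * sin (n * π * x) = 0) (m : ℕ) :
    ∀ n : ℕ, ∫ x in (0:ℝ)..1, g x * (sin (n * π * x) * cos (π * x) ^ m) = 0 := by
  have hint : ∀ f : ℝ → ℝ, Continuous f →
      IntervalIntegrable (fun x => g x * f x) MeasureTheory.volume 0 1 := fun f hf =>
    ContinuousOn.intervalIntegrable (by
      rw [uIcc_of_le zero_le_one]; exact hg.mul hf.continuousOn)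
  induction m with
  | zero => simpa using h
  | succ m ih =>
    intro n
    rcases n with _ | n
    · simp
    have e : ∀ x : ℝ, g x * (sin ((n + 1 : ℕ) * π * x) * cos (π * x) ^ (m + 1)) =
        (1 / 2) * (g x * (sin ((n + 2 : ℕ) * π * x) * cos (π * x) ^ m)) +
        (1 / 2) * (g x * (sin (n * π * x) * cos (π * x) ^ m)) := by
      intro x
      have e1 : sin ((n + 2 : ℕ) * π * x) = sin ((n + 1 : ℕ) * π * x + π * x) := by
        push_cast; ring_nf
      have e2 : sin (n * π * x) = sin ((n + 1 : ℕ) * π * x - π * x) := by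
        push_cast; ring_nf
      rw [e1, e2, sin_add, sin_sub]
      ring
    simp_rw [e]
    rw [intervalIntegral.integral_add ((hint _ (by fun_prop)).const_mul _)
      ((hint _ (by fun_prop)).const_mul _), intervalIntegral.integral_const_mul,
      intervalIntegral.integral_const_mul, ih, ih]
    simp

lemma integral_mul_sin_mul_eval_cos_eq_zero {g : ℝ → ℝ} (hg : ContinuousOn g (Icc 0 1))
    (h : ∀ n : ℕ, ∫ x in (0:ℝ)..1, g x * sin (n * π * x) = 0) (p : Polynomial ℝ) :
    ∫ x in (0:ℝ)..1, g x * (sin (π * x) * p.eval (cos (π * x))) = 0 := by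
  have hint : ∀ f : ℝ → ℝ, Continuous f →
      IntervalIntegrable (fun x => g x * f x) MeasureTheory.volume 0 1 := fun f hf =>
    ContinuousOn.intervalIntegrable (by
      rw [uIcc_of_le zero_le_one]; exact hg.mul hf.continuousOn)
  induction p using Polynomial.induction_on' with
  | add p q hp hq =>
    simp only [Polynomial.eval_add, mul_add]
    rw [intervalIntegral.integral_add (hint _ (by fun_prop)) (hint _ (by fun_prop)), hp, hq,
      add_zero]
  | monomial m a =>
    have := integral_mul_sin_mul_cos_pow_eq_zero hg h m 1
    simp only [Nat.cast_one, one_mul] at this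
    have e : ∀ x, g x * (sin (π * x) * (Polynomial.monomial m a).eval (cos (π * x))) =
        a * (g x * (sin (π * x) * cos (π * x) ^ m)) := fun x => by
      rw [Polynomial.eval_monomial]; ring
    simp_rw [e]
    rw [intervalIntegral.integral_const_mul, this, mul_zero]

/-- Completeness of the sine system in `C[0,1]`. -/
lemma eq_zero_of_integral_mul_sin_eq_zero {g : ℝ → ℝ} (hg : ContinuousOn g (Icc 0 1))
    (h : ∀ n : ℕ, ∫ x in (0:ℝ)..1, g x * sin (n * π * x) = 0) :
    ∀ x ∈ Icc (0:ℝ) 1, g x = 0 := by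
  obtain ⟨B, hB⟩ := isCompact_Icc.exists_bound_of_continuousOn hg
  have hB0 : 0 ≤ B := (norm_nonneg _).trans (hB 0 (by simp))
  have hsin : ∀ x ∈ Icc (0:ℝ) 1, 0 ≤ sin (π * x) := fun x hx =>
    sin_nonneg_of_nonneg_of_le_pi (mul_nonneg pi_pos.le hx.1)
      (by nlinarith [pi_pos, hx.2])
  have hc2 : ContinuousOn (fun x => g x * (sin (π * x) * g x)) (Icc 0 1) :=
    hg.mul ((Continuous.continuousOn (by fun_prop)).mul hg)
  have hle : ∫ x in (0:ℝ)..1, g x * (sin (π * x) * g x) ≤ 0 := by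
    refine le_of_forall_pos_le_add fun ε hε => ?_
    have hG : ContinuousOn (fun z => g (arccos z / π)) (Icc (-1) 1) := by
      refine hg.comp (Continuous.continuousOn (by fun_prop)) fun z _ => ?_
      exact ⟨div_nonneg (arccos_nonneg z) pi_pos.le, (div_le_one pi_pos).2 (arccos_le_pi z)⟩
    obtain ⟨p, hp⟩ := exists_polynomial_near_of_continuousOn (-1) 1 _ hG (ε / (B + 1))
      (by positivity)
    have hp' : ∀ x ∈ Icc (0:ℝ) 1, |p.eval (cos (π * x)) - g x| < ε / (B + 1) := by
      intro x hx
      have := hp (cos (π * x)) ⟨neg_one_le_cos _, cos_le_one _⟩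
      rwa [arccos_cos (mul_nonneg pi_pos.le hx.1) (by nlinarith [pi_pos, hx.2]),
        mul_div_cancel_left₀ _ pi_ne_zero] at this
    have hi1 : IntervalIntegrable (fun x => g x * (sin (π * x) * g x))
        MeasureTheory.volume 0 1 :=
      ContinuousOn.intervalIntegrable (by rwa [uIcc_of_le zero_le_one])
    have hi2 : IntervalIntegrable (fun x => g x * (sin (π * x) * p.eval (cos (π * x))))
        MeasureTheory.volume 0 1 :=
      ContinuousOn.intervalIntegrable (by
        rw [uIcc_of_le zero_le_one]
        exact hg.mul (Continuous.continuousOn (by fun_prop)))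
    have h0 := integral_mul_sin_mul_eval_cos_eq_zero hg h p
    have : ∫ x in (0:ℝ)..1, g x * (sin (π * x) * g x) =
        ∫ x in (0:ℝ)..1, (g x * (sin (π * x) * g x) -
          g x * (sin (π * x) * p.eval (cos (π * x)))) := by
      rw [intervalIntegral.integral_sub hi1 hi2, h0, sub_zero]
    rw [this, zero_add]
    have hmono : ∫ x in (0:ℝ)..1, (g x * (sin (π * x) * g x) -
          g x * (sin (π * x) * p.eval (cos (π * x)))) ≤ ∫ x in (0:ℝ)..1, ε := by
      refine intervalIntegral.integral_mono_on zero_le_one (hi1.sub hi2) (by simp) fun x hx => ?_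
      have e : g x * (sin (π * x) * g x) - g x * (sin (π * x) * p.eval (cos (π * x))) =
        -(g x * sin (π * x) * (p.eval (cos (π * x)) - g x)) := by ring
      rw [e]
      refine (neg_le_abs _).trans ?_
      rw [abs_mul, abs_mul]
      have h1 : |g x| ≤ B := hB x hx
      have h2 : |sin (π * x)| ≤ 1 := abs_sin_le_one _
      calc |g x| * |sin (π * x)| * |p.eval (cos (π * x)) - g x|
          ≤ B * 1 * (ε / (B + 1)) := by
            gcongr
            exact (hp' x hx).le
        _ ≤ ε := by
            rw [mul_one, mul_div_assoc', div_le_iff₀ (by positivity)]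
            nlinarith
    simpa using hmono
  have hIoo : ∀ x ∈ Ioo (0:ℝ) 1, g x = 0 := by
    intro x hx
    by_contra hne
    have hspos : 0 < sin (π * x) :=
      sin_pos_of_pos_of_lt_pi (mul_pos pi_pos hx.1) (by nlinarith [pi_pos, hx.2])
    have := intervalIntegral.integral_pos (zero_lt_one' ℝ) hc2
      (fun y hy => by
        have := hsin y (Ioc_subset_Icc_self hy)
        nlinarith [mul_nonneg this (mul_self_nonneg (g y))])
      ⟨x, Ioo_subset_Icc_self hx, by
        have := mul_self_pos.2 hne
        nlinarith [mul_pos hspos this]⟩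
    linarith
  have hcl : Icc (0:ℝ) 1 ⊆ closure (Ioo 0 1) := by rw [closure_Ioo zero_ne_one]
  have : EqOn g (fun _ => 0) (Icc 0 1) :=
    EqOn.of_subset_closure (s := Ioo (0:ℝ) 1) (fun x hx => hIoo x hx) hg continuousOn_const
      Ioo_subset_Icc_self hcl
  exact this
/-- The `n`-th sine coefficient of a function on `[0,1]`. -/
noncomputable def sineCoeff (g : ℝ → ℝ) (n : ℕ) : ℝ :=
  2 * ∫ y in (0:ℝ)..1, g y * sin (n * π * y)

lemma sum_cos_sq_add_sum_sin_sq (k : ℕ) (z : ℝ) :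
    (∑ j ∈ Finset.range k, cos (j * z)) ^ 2 + (∑ j ∈ Finset.range k, sin (j * z)) ^ 2 =
      2 * ∑ j ∈ Finset.range k, ((k : ℝ) - j) * cos (j * z) - k := by
  induction k with
  | zero => simp
  | succ k ih =>
    have h1 : ∑ j ∈ Finset.range (k + 1), (((k + 1 : ℕ) : ℝ) - j) * cos (j * z) =
        ∑ j ∈ Finset.range k, ((k : ℝ) - j) * cos (j * z) +
          ∑ j ∈ Finset.range (k + 1), cos (j * z) := by
      rw [Finset.sum_range_succ, Finset.sum_range_succ, ← add_assoc, ← Finset.sum_add_distrib]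
      congr 1
      · exact Finset.sum_congr rfl fun j _ => by push_cast; ring
      · push_cast; ring
    have h2 : cos (k * z) * ∑ j ∈ Finset.range k, cos (j * z) +
        sin (k * z) * ∑ j ∈ Finset.range k, sin (j * z) =
        ∑ j ∈ Finset.range (k + 1), cos (j * z) - 1 := by
      rw [Finset.sum_range_succ', Finset.mul_sum, Finset.mul_sum, ← Finset.sum_add_distrib,
        ← Finset.sum_range_reflect]
      simp only [Nat.cast_zero, zero_mul, cos_zero, add_sub_cancel_right]
      refine Finset.sum_congr rfl fun j hj => ?_
      have hj' : j + 1 ≤ k := Finset.mem_range.1 hj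
      have : k - 1 - j = k - (j + 1) := by omega
      rw [this, Nat.cast_sub hj', ← cos_sub]
      congr 1
      push_cast
      ring
    rw [h1, Finset.sum_range_succ (fun j : ℕ => sin (j * z))]
    have h3 := Finset.sum_range_succ (fun j : ℕ => cos (j * z)) k
    have h4 := sin_sq_add_cos_sq (k * z)
    rw [h3] at h2 ⊢
    push_cast
    nlinarith

lemma integral_cos_nat_mul_pi (j : ℕ) (hj : j ≠ 0) :
    ∫ y in (0:ℝ)..1, cos (j * π * y) = 0 := by
  have hj' : (j : ℝ) * π ≠ 0 := mul_ne_zero (by exact_mod_cast hj) pi_ne_zero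
  rw [intervalIntegral.integral_comp_mul_left (fun x => cos x) hj', integral_cos]
  simp [sin_nat_mul_pi]

lemma abs_fejer_sum_le {g : ℝ → ℝ} (hg : Continuous g) {B : ℝ} (hB : ∀ y, |g y| ≤ B)
    (k : ℕ) (x : ℝ) :
    |∑ j ∈ Finset.range k, ((k : ℝ) - j) * (sineCoeff g j * sin (j * π * x))| ≤ k * B := by
  set Q : ℝ → ℝ := fun z => 2 * ∑ j ∈ Finset.range k, ((k : ℝ) - j) * cos (j * z) - k with hQ
  have hQ0 : ∀ z, 0 ≤ Q z := fun z => by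
    simp only [hQ]; rw [← sum_cos_sq_add_sum_sin_sq]; positivity
  have hQc : Continuous Q := by fun_prop
  have e1 : ∑ j ∈ Finset.range k, ((k : ℝ) - j) * (sineCoeff g j * sin (j * π * x)) =
      ∫ y in (0:ℝ)..1, g y * ((Q (π * (x - y)) - Q (π * (x + y))) / 2) := by
    have : ∀ j ∈ Finset.range k, ((k : ℝ) - j) * (sineCoeff g j * sin (j * π * x)) =
        ∫ y in (0:ℝ)..1, ((k : ℝ) - j) * 2 * sin (j * π * x) * (g y * sin (j * π * y)) := by
      intro j _
      rw [intervalIntegral.integral_const_mul, sineCoeff]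
      ring
    rw [Finset.sum_congr rfl this, ← intervalIntegral.integral_finsetSum]
    · refine intervalIntegral.integral_congr fun y _ => ?_
      simp only [hQ]
      rw [sub_sub_sub_cancel_right, ← mul_sub, ← Finset.sum_sub_distrib,
        mul_div_cancel_left₀ _ two_ne_zero, Finset.mul_sum]
      refine Finset.sum_congr rfl fun j _ => ?_
      have h1 : cos (j * (π * (x - y))) = cos (j * π * x - j * π * y) := by ring_nf
      have h2 : cos (j * (π * (x + y))) = cos (j * π * x + j * π * y) := by ring_nf
      rw [h1, h2, cos_sub, cos_add]
      ring
    · intro j _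
      exact Continuous.intervalIntegrable (by fun_prop) _ _
  have e2 : ∫ y in (0:ℝ)..1, (Q (π * (x - y)) + Q (π * (x + y))) / 2 = k := by
    have : ∀ y, (Q (π * (x - y)) + Q (π * (x + y))) / 2 =
        (∑ j ∈ Finset.range k, ((k : ℝ) - j) * 2 * cos (j * π * x) * cos (j * π * y)) - k := by
      intro y
      simp only [hQ]
      have h3 : ∑ j ∈ Finset.range k, ((k : ℝ) - j) * 2 * cos (j * π * x) * cos (j * π * y) =
          ∑ j ∈ Finset.range k, ((k : ℝ) - j) * cos (j * (π * (x - y))) +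
          ∑ j ∈ Finset.range k, ((k : ℝ) - j) * cos (j * (π * (x + y))) := by
        rw [← Finset.sum_add_distrib]
        refine Finset.sum_congr rfl fun j _ => ?_
        have h1 : cos (j * (π * (x - y))) = cos (j * π * x - j * π * y) := by ring_nf
        have h2 : cos (j * (π * (x + y))) = cos (j * π * x + j * π * y) := by ring_nf
        rw [h1, h2, cos_sub, cos_add]
        ring
      rw [h3]
      ring
    simp_rw [this]
    rw [intervalIntegral.integral_sub (Continuous.intervalIntegrable (by fun_prop) _ _)
      (by simp), intervalIntegral.integral_finsetSum
        (fun j _ => Continuous.intervalIntegrable (by fun_prop) _ _)]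
    simp_rw [intervalIntegral.integral_const_mul]
    rcases k with _ | k
    · simp
    rw [Finset.sum_range_succ', Finset.sum_eq_zero]
    · simp; ring
    · intro j _
      rw [integral_cos_nat_mul_pi _ (Nat.succ_ne_zero j), mul_zero]
  have hB0 : 0 ≤ B := (abs_nonneg _).trans (hB 0)
  rw [e1, ← e2, mul_comm, ← intervalIntegral.integral_const_mul, ← Real.norm_eq_abs]
  refine intervalIntegral.norm_integral_le_of_norm_le zero_le_one
    (Filter.Eventually.of_forall fun y _ => ?_) (Continuous.intervalIntegrable (by fun_prop) _ _)
  rw [norm_mul, Real.norm_eq_abs, Real.norm_eq_abs]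
  refine mul_le_mul (hB y) ?_ (abs_nonneg _) hB0
  have a := hQ0 (π * (x - y))
  have b := hQ0 (π * (x + y))
  rw [abs_le]
  constructor <;> linarith

lemma abs_sineCoeff_le {g : ℝ → ℝ} {B : ℝ} (hB : ∀ y, |g y| ≤ B) (n : ℕ) :
    |sineCoeff g n| ≤ 2 * B := by
  have hB0 : 0 ≤ B := (abs_nonneg _).trans (hB 0)
  rw [sineCoeff, abs_mul, abs_two]
  have := intervalIntegral.norm_integral_le_of_norm_le_const (a := (0:ℝ)) (b := 1) (C := B)
    (f := fun y => g y * sin (n * π * y)) (fun y _ => by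
      rw [norm_mul, Real.norm_eq_abs, Real.norm_eq_abs]
      calc |g y| * |sin (n * π * y)| ≤ B * 1 :=
            mul_le_mul (hB y) (abs_sin_le_one _) (abs_nonneg _) hB0
        _ = B := mul_one B)
  simp only [sub_zero, abs_one, mul_one, Real.norm_eq_abs] at this
  linarith

lemma sineCoeff_sub {f g : ℝ → ℝ} (hf : Continuous f) (hg : Continuous g) (n : ℕ) :
    sineCoeff (fun y => f y - g y) n = sineCoeff f n - sineCoeff g n := by
  simp only [sineCoeff, sub_mul]
  rw [intervalIntegral.integral_sub (Continuous.intervalIntegrable (by fun_prop) _ _)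
    (Continuous.intervalIntegrable (by fun_prop) _ _), mul_sub]

lemma sineCoeff_add {f g : ℝ → ℝ} (hf : Continuous f) (hg : Continuous g) (n : ℕ) :
    sineCoeff (fun y => f y + g y) n = sineCoeff f n + sineCoeff g n := by
  simp only [sineCoeff, add_mul]
  rw [intervalIntegral.integral_add (Continuous.intervalIntegrable (by fun_prop) _ _)
    (Continuous.intervalIntegrable (by fun_prop) _ _), mul_add]

lemma sineCoeff_zero (g : ℝ → ℝ) : sineCoeff g 0 = 0 := by simp [sineCoeff]

lemma sineCoeff_const_mul (c : ℝ) (g : ℝ → ℝ) (n : ℕ) :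
    sineCoeff (fun y => c * g y) n = c * sineCoeff g n := by
  simp only [sineCoeff, mul_assoc, intervalIntegral.integral_const_mul]
  ring

lemma sineCoeff_sin (j n : ℕ) (hn : n ≠ 0) :
    sineCoeff (fun y => sin (j * π * y)) n = if j = n then 1 else 0 := by
  have e : ∀ y : ℝ, sin (j * π * y) * sin (n * π * y) =
      (cos (((j : ℤ) - n : ℤ) * π * y) - cos (((j + n : ℕ) : ℝ) * π * y)) / 2 := by
    intro y
    have h1 : cos (((j : ℤ) - n : ℤ) * π * y) = cos (j * π * y - n * π * y) := by
      push_cast; ring_nf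
    have h2 : cos (((j + n : ℕ) : ℝ) * π * y) = cos (j * π * y + n * π * y) := by
      push_cast; ring_nf
    rw [h1, h2, cos_sub, cos_add]
    ring
  simp only [sineCoeff]
  simp_rw [e]
  rw [intervalIntegral.integral_div, intervalIntegral.integral_sub
    (Continuous.intervalIntegrable (by fun_prop) _ _)
    (Continuous.intervalIntegrable (by fun_prop) _ _),
    integral_cos_nat_mul_pi _ (by omega)]
  split_ifs with h
  · subst h; simp
  · have hne : ((j : ℤ) - n : ℤ) ≠ 0 := by omega
    have : (((j : ℤ) - n : ℤ) : ℝ) * π ≠ 0 := mul_ne_zero (by exact_mod_cast hne) pi_ne_zero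
    rw [intervalIntegral.integral_comp_mul_left (fun x => cos x) this, integral_cos]
    simp [-Int.cast_sub, sin_int_mul_pi]

lemma eqOn_of_sineCoeff_eq {f g : ℝ → ℝ} (hf : Continuous f) (hg : Continuous g)
    (h : ∀ n : ℕ, n ≠ 0 → sineCoeff f n = sineCoeff g n) :
    EqOn f g (Icc 0 1) := by
  intro x hx
  have := eq_zero_of_integral_mul_sin_eq_zero (g := fun y => f y - g y)
    (Continuous.continuousOn (by fun_prop)) (fun n => by
      have h1 := sineCoeff_sub hf hg n
      rcases eq_or_ne n 0 with rfl | hn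
      · simp
      · rw [h n hn, sub_self, sineCoeff] at h1
        simpa using h1) x hx
  simpa [sub_eq_zero] using this
/-- The bounded solution of `y' + a y = h`. -/
noncomputable def expConv (a : ℝ) (h : ℝ → ℝ) (t : ℝ) : ℝ :=
  ∫ s in Ioi (0:ℝ), exp (-(a * s)) * h (t - s)

lemma integrableOn_exp_neg_mul {a : ℝ} (ha : 0 < a) (c : ℝ) :
    MeasureTheory.IntegrableOn (fun s : ℝ => exp (-(a * s))) (Ioi c) := by
  simpa [neg_mul] using exp_neg_integrableOn_Ioi c ha

lemma integral_exp_neg_mul {a : ℝ} (ha : 0 < a) :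
    ∫ s in Ioi (0:ℝ), exp (-(a * s)) = 1 / a := by
  have := integral_exp_mul_Ioi (neg_lt_zero.2 ha) 0
  simp only [neg_mul, mul_zero, exp_zero] at this
  rw [this, neg_div_neg_eq]

lemma integrableOn_exp_neg_mul_mul {a : ℝ} (ha : 0 < a) {h : ℝ → ℝ} (hc : Continuous h)
    {B : ℝ} (hB : ∀ t, |h t| ≤ B) (c : ℝ) :
    MeasureTheory.IntegrableOn (fun s : ℝ => exp (-(a * s)) * h s) (Ioi c) :=
  (integrableOn_exp_neg_mul ha c).mul_bdd (c := B) hc.aestronglyMeasurable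
    (Filter.Eventually.of_forall hB)

lemma abs_expConv_le {a : ℝ} (ha : 0 < a) {h : ℝ → ℝ} {B : ℝ} (hB : ∀ t, |h t| ≤ B) (t : ℝ) :
    |expConv a h t| ≤ B / a := by
  have : B / a = ∫ s in Ioi (0:ℝ), exp (-(a * s)) * B := by
    rw [MeasureTheory.integral_mul_const, integral_exp_neg_mul ha]; ring
  rw [this, expConv, ← Real.norm_eq_abs]
  refine MeasureTheory.norm_integral_le_of_norm_le ((integrableOn_exp_neg_mul ha 0).mul_const B)
    (Filter.Eventually.of_forall fun s => ?_)
  rw [norm_mul, Real.norm_eq_abs, Real.norm_eq_abs, abs_of_pos (exp_pos _)]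
  exact mul_le_mul_of_nonneg_left (hB _) (exp_pos _).le

lemma setIntegral_Ioi_comp_add_right (f : ℝ → ℝ) (c : ℝ) :
    ∫ s in Ioi (0:ℝ), f (s + c) = ∫ s in Ioi c, f s := by
  have A : MeasurableEmbedding fun x : ℝ => x + c :=
    (Homeomorph.addRight c).isClosedEmbedding.measurableEmbedding
  have := A.setIntegral_map (μ := MeasureTheory.volume) f (Ioi c)
  rw [MeasureTheory.map_add_right_eq_self] at this
  rw [this]
  simp

lemma hasDerivAt_expConv {a : ℝ} (ha : 0 < a) {h : ℝ → ℝ} (hc : Continuous h) {B : ℝ}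
    (hB : ∀ t, |h t| ≤ B) (t : ℝ) :
    HasDerivAt (expConv a h) (h t - a * expConv a h t) t := by
  set F : ℝ → ℝ := fun s => exp (-(a * s)) * h (-s) with hF
  have hFc : Continuous F := by fun_prop
  have hint : ∀ c, MeasureTheory.IntegrableOn F (Ioi c) := fun c =>
    integrableOn_exp_neg_mul_mul ha (h := fun s => h (-s)) (by fun_prop) (fun s => hB (-s)) c
  have e : ∀ t, expConv a h t = exp (-(a * t)) * ((∫ s in Ioi (0:ℝ), F s) -
      ∫ s in (0:ℝ)..(-t), F s) := by
    intro t
    rw [← intervalIntegral.integral_interval_add_Ioi (hint 0) (hint (-t)), add_sub_cancel_left,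
      ← setIntegral_Ioi_comp_add_right, ← MeasureTheory.integral_const_mul, expConv]
    refine MeasureTheory.integral_congr_ae (Filter.Eventually.of_forall fun s => ?_)
    simp only [hF]
    rw [← mul_assoc, ← exp_add]
    ring_nf
  have hd0 : HasDerivAt (fun t : ℝ => ∫ s in (0:ℝ)..(-t), F s) (F (-t) * (-1)) t :=
    (hFc.integral_hasStrictDerivAt 0 (-t)).hasDerivAt.comp t (hasDerivAt_neg t)
  have hd := (((hasDerivAt_id t).const_mul a).neg.exp).mul
    (hd0.const_sub (∫ s in Ioi (0:ℝ), F s))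
  have hd1 := hd.congr_of_eventuallyEq (f₁ := expConv a h) (Filter.Eventually.of_forall e)
  convert! hd1 using 1
  rw [e t]
  have : exp (-(a * t)) * exp (-(a * -t)) = 1 := by rw [← exp_add]; simp
  simp only [hF, neg_neg, id]
  linear_combination (-h t) * this

lemma expConv_periodic {ω a : ℝ} {h : ℝ → ℝ} (hp : ∀ t, h (t + ω) = h t) (t : ℝ) :
    expConv a h (t + ω) = expConv a h t := by
  simp only [expConv]
  congr 1
  ext s
  rw [show t + ω - s = t - s + ω by ring, hp]

/-- The defect `a (∂ₜ + a)⁻¹ h - h`. -/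
noncomputable def lagDefect (a : ℝ) (h : ℝ → ℝ) (t : ℝ) : ℝ := a * expConv a h t - h t

lemma lagDefect_eq_integral {a : ℝ} (ha : 0 < a) {h : ℝ → ℝ} (hc : Continuous h) {B : ℝ}
    (hB : ∀ t, |h t| ≤ B) (t : ℝ) :
    lagDefect a h t = ∫ s in Ioi (0:ℝ), a * exp (-(a * s)) * (h (t - s) - h t) := by
  have h1 := (integrableOn_exp_neg_mul_mul ha (h := fun s => h (t - s)) (by fun_prop)
    (fun s => hB (t - s)) 0).const_mul a
  have h2 := ((integrableOn_exp_neg_mul ha 0).mul_const (h t)).const_mul a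
  have e : ∀ s, a * exp (-(a * s)) * (h (t - s) - h t) =
      a * (exp (-(a * s)) * h (t - s)) - a * (exp (-(a * s)) * h t) := fun s => by ring
  simp_rw [e]
  rw [MeasureTheory.integral_sub h1 h2, MeasureTheory.integral_const_mul,
    MeasureTheory.integral_const_mul, MeasureTheory.integral_mul_const, integral_exp_neg_mul ha,
    lagDefect, expConv]
  field_simp

lemma integrableOn_exp_mul_sub {a : ℝ} (ha : 0 < a) {h : ℝ → ℝ} (hc : Continuous h) {B : ℝ}
    (hB : ∀ t, |h t| ≤ B) (t : ℝ) :
    MeasureTheory.IntegrableOn (fun s => a * exp (-(a * s)) * (h (t - s) - h t)) (Ioi 0) := by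
  have h1 := (integrableOn_exp_neg_mul_mul ha (h := fun s => h (t - s) - h t) (by fun_prop)
    (B := B + B) (fun s => (abs_sub _ _).trans (add_le_add (hB _) (hB _))) 0).const_mul a
  simpa only [mul_assoc, MeasureTheory.IntegrableOn] using h1

lemma integral_exp_mul_rpow {a θ : ℝ} (ha : 0 < a) (hθ : 0 < θ) :
    MeasureTheory.IntegrableOn (fun s => exp (-(a * s)) * s ^ θ) (Ioi 0) ∧
    ∫ s in Ioi (0:ℝ), exp (-(a * s)) * s ^ θ = Gamma (θ + 1) * a ^ (-(θ + 1)) := by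
  have h1 := integral_rpow_mul_exp_neg_mul_Ioi (a := θ + 1) (r := a) (by linarith) ha
  have h2 : ∀ s : ℝ, s ^ (θ + 1 - 1) * exp (-(a * s)) = exp (-(a * s)) * s ^ θ := fun s => by
    rw [add_sub_cancel_right, mul_comm]
  simp_rw [h2] at h1
  have h3 : ∫ s in Ioi (0:ℝ), exp (-(a * s)) * s ^ θ = Gamma (θ + 1) * a ^ (-(θ + 1)) := by
    rw [h1, one_div, inv_rpow ha.le, rpow_neg ha.le, mul_comm]
  refine ⟨?_, h3⟩
  by_contra hne
  have := MeasureTheory.integral_undef hne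
  rw [h3] at this
  have hG := Gamma_pos_of_pos (show 0 < θ + 1 by linarith)
  exact (mul_pos hG (rpow_pos_of_pos ha (-(θ + 1)))).ne' this
/-- The eigenvalue symbol of `γ ∂⁴ - ∂² - 1` at frequency `ξ`. -/
noncomputable def eig (γ ξ : ℝ) : ℝ := γ * π ^ 4 * ξ ^ 4 + π ^ 2 * ξ ^ 2 - 1

lemma one_lt_pi_sq : 1 < π ^ 2 := by nlinarith [pi_gt_three]

lemma le_eig {γ ξ : ℝ} (hξ : 1 ≤ ξ) : γ * π ^ 4 * ξ ^ 4 ≤ eig γ ξ := by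
  have : 1 ≤ π ^ 2 * ξ ^ 2 := one_le_mul_of_one_le_of_one_le one_lt_pi_sq.le (one_le_pow₀ hξ)
  simp only [eig]; linarith

lemma eig_le {γ ξ : ℝ} (hξ : 1 ≤ ξ) : eig γ ξ ≤ (γ * π ^ 4 + π ^ 2) * ξ ^ 4 := by
  have h1 : ξ ^ 2 ≤ ξ ^ 4 := pow_le_pow_right₀ hξ (by norm_num)
  have h2 := mul_le_mul_of_nonneg_left h1 (sq_nonneg π)
  simp only [eig]; nlinarith

lemma eig_pos {γ ξ : ℝ} (hγ : 0 < γ) (hξ : 1 ≤ ξ) : 0 < eig γ ξ :=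
  lt_of_lt_of_le (by positivity) (le_eig hξ)

lemma exists_second_difference_eq {f f' f'' : ℝ → ℝ} {x : ℝ}
    (h1 : ∀ y, HasDerivAt f (f' y) y) (h2 : ∀ y, HasDerivAt f' (f'' y) y) :
    ∃ z ∈ Icc x (x + 2), f (x + 2) - 2 * f (x + 1) + f x = f'' z := by
  have hg : ∀ y, HasDerivAt (fun y => f (y + 1) - f y) (f' (y + 1) - f' y) y := fun y =>
    ((h1 (y + 1)).comp_add_const y 1).sub (h1 y)
  obtain ⟨c, hc, hce⟩ := exists_hasDerivAt_eq_slope (fun y => f (y + 1) - f y)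
    (fun y => f' (y + 1) - f' y) (show x < x + 1 by linarith)
    (HasDerivAt.continuousOn fun y _ => hg y) (fun y _ => hg y)
  obtain ⟨z, hz, hze⟩ := exists_hasDerivAt_eq_slope f' f'' (show c < c + 1 by linarith)
    (HasDerivAt.continuousOn fun y _ => h2 y) (fun y _ => h2 y)
  refine ⟨z, ⟨by linarith [hc.1, hz.1], by linarith [hc.2, hz.2]⟩, ?_⟩
  rw [hze, add_sub_cancel_left, div_one, hce, add_sub_cancel_left, div_one,
    show x + 1 + 1 = x + 2 by ring]
  ring

/-- The symbol of the operator `A exp (-s A)`. -/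
noncomputable def heatSymbol (γ s ξ : ℝ) : ℝ := eig γ ξ * exp (-(eig γ ξ * s))

/-- The derivative of `eig γ`. -/
noncomputable def eigDeriv (γ ξ : ℝ) : ℝ := 4 * γ * π ^ 4 * ξ ^ 3 + 2 * π ^ 2 * ξ

/-- The second derivative of `eig γ`. -/
noncomputable def eigDeriv₂ (γ ξ : ℝ) : ℝ := 12 * γ * π ^ 4 * ξ ^ 2 + 2 * π ^ 2

lemma hasDerivAt_eig (γ y : ℝ) : HasDerivAt (eig γ) (eigDeriv γ y) y := by
  have := (((hasDerivAt_pow 4 y).const_mul (γ * π ^ 4)).add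
    ((hasDerivAt_pow 2 y).const_mul (π ^ 2))).sub_const 1
  convert! this using 1
  simp only [eigDeriv]; push_cast; ring

lemma hasDerivAt_eigDeriv (γ y : ℝ) : HasDerivAt (eigDeriv γ) (eigDeriv₂ γ y) y := by
  have := ((hasDerivAt_pow 3 y).const_mul (4 * γ * π ^ 4)).add
    ((hasDerivAt_id y).const_mul (2 * π ^ 2))
  convert! this using 1
  simp only [eigDeriv₂]; push_cast; ring

lemma exists_second_difference_heatSymbol_eq (γ s ξ : ℝ) :
    ∃ z ∈ Icc ξ (ξ + 2),
      heatSymbol γ s (ξ + 2) - 2 * heatSymbol γ s (ξ + 1) + heatSymbol γ s ξ =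
        (eigDeriv₂ γ z * (1 - s * eig γ z) + eigDeriv γ z ^ 2 * (s * (s * eig γ z - 2))) *
          exp (-(eig γ z * s)) := by
  have dE : ∀ y, HasDerivAt (fun y => exp (-(eig γ y * s)))
      (exp (-(eig γ y * s)) * (-(eigDeriv γ y * s))) y :=
    fun y => ((hasDerivAt_eig γ y).mul_const s).neg.exp
  have D1 : ∀ y, HasDerivAt (heatSymbol γ s)
      (eigDeriv γ y * (1 - s * eig γ y) * exp (-(eig γ y * s))) y := by
    intro y
    have := (hasDerivAt_eig γ y).mul (dE y)
    convert! this using 1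
    ring
  have D2 : ∀ y, HasDerivAt (fun y => eigDeriv γ y * (1 - s * eig γ y) * exp (-(eig γ y * s)))
      ((eigDeriv₂ γ y * (1 - s * eig γ y) + eigDeriv γ y ^ 2 * (s * (s * eig γ y - 2))) *
        exp (-(eig γ y * s))) y := by
    intro y
    have := ((hasDerivAt_eigDeriv γ y).mul
      (((hasDerivAt_eig γ y).const_mul s).const_sub 1)).mul (dE y)
    convert! this using 1
    simp only [Pi.mul_apply]
    ring
  exact exists_second_difference_eq D1 D2

lemma abs_symbol_deriv₂_le {K z s l l' l'' : ℝ} (hK : 0 < K) (hz : 0 < z) (hs : 0 < s)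
    (hl0 : 0 < l) (hl : l ≤ K * z ^ 4) (hl0' : 0 ≤ l') (hl' : l' ≤ 4 * K * z ^ 3)
    (hl0'' : 0 ≤ l'') (hl'' : l'' ≤ 12 * K * z ^ 2) :
    |l'' * (1 - s * l) + l' ^ 2 * (s * (s * l - 2))| ≤
      z ^ 2 * (12 * K + 44 * K ^ 2 * (z ^ 4 * s) + 16 * K ^ 3 * (z ^ 4 * s) ^ 2) := by
  have h1 : s * l ≤ K * (z ^ 4 * s) := by nlinarith
  have h2 : 0 < s * l := by positivity
  have t1 : |l'' * (1 - s * l)| ≤ 12 * K * z ^ 2 * (1 + K * (z ^ 4 * s)) := by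
    rw [abs_mul, abs_of_nonneg hl0'']
    refine mul_le_mul hl'' ?_ (abs_nonneg _) (by positivity)
    rw [abs_le]; constructor <;> linarith
  have t2 : |l' ^ 2 * (s * (s * l - 2))| ≤
      (4 * K * z ^ 3) ^ 2 * (s * (K * (z ^ 4 * s) + 2)) := by
    rw [abs_mul, abs_of_nonneg (sq_nonneg _)]
    refine mul_le_mul (pow_le_pow_left₀ hl0' hl' 2) ?_ (abs_nonneg _) (by positivity)
    rw [abs_mul, abs_of_pos hs]
    refine mul_le_mul_of_nonneg_left ?_ hs.le
    rw [abs_le]; constructor <;> linarith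
  refine (abs_add_le _ _).trans ((add_le_add t1 t2).trans (le_of_eq ?_))
  ring

lemma mul_exp_neg_le {α y : ℝ} (hα : 0 < α) : y * exp (-(α / 2 * y)) ≤ 2 / α := by
  have h := add_one_le_exp (α / 2 * y)
  rw [exp_neg, ← div_eq_mul_inv, div_le_iff₀ (exp_pos _), div_mul_eq_mul_div,
    le_div_iff₀ hα]
  linarith

lemma sq_mul_exp_neg_le {α y : ℝ} (hα : 0 < α) (hy : 0 < y) :
    y ^ 2 * exp (-(α / 2 * y)) ≤ 2 * (2 / α) ^ 2 := by
  have h := quadratic_le_exp_of_nonneg (x := α / 2 * y) (by positivity)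
  rw [exp_neg, ← div_eq_mul_inv, div_le_iff₀ (exp_pos _), div_pow, ← mul_div_assoc,
    div_mul_eq_mul_div, le_div_iff₀ (by positivity)]
  have : 0 ≤ α / 2 * y := by positivity
  nlinarith

lemma exists_abs_second_difference_heatSymbol_le {γ : ℝ} (hγ : 0 < γ) :
    ∃ C > 0, ∃ c > 0, ∀ s > 0, ∀ ξ ≥ 1,
      |heatSymbol γ s (ξ + 2) - 2 * heatSymbol γ s (ξ + 1) + heatSymbol γ s ξ| ≤
        C * ξ ^ 2 * exp (-(c * ξ ^ 4 * s)) := by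
  set α := γ * π ^ 4 with hα
  have hα0 : 0 < α := by positivity
  set K := γ * π ^ 4 + π ^ 2 with hK
  have hK0 : 0 < K := by positivity
  refine ⟨9 * (12 * K + 44 * K ^ 2 * (2 / α) + 16 * K ^ 3 * (2 * (2 / α) ^ 2)), by positivity,
    α / 2, by positivity, fun s hs ξ hξ => ?_⟩
  obtain ⟨z, hz, he⟩ := exists_second_difference_heatSymbol_eq γ s ξ
  rw [he]
  have hz1 : 1 ≤ z := hξ.trans hz.1
  have hz0 : 0 < z := by linarith
  have hlz1 : α * z ^ 4 ≤ eig γ z := le_eig hz1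
  have hl'z : 0 ≤ eigDeriv γ z := by simp only [eigDeriv]; positivity
  have hl''z : 0 ≤ eigDeriv₂ γ z := by simp only [eigDeriv₂]; positivity
  have hl'z2 : eigDeriv γ z ≤ 4 * K * z ^ 3 := by
    have : z ≤ z ^ 3 := le_self_pow₀ hz1 (by norm_num)
    simp only [eigDeriv, hK]
    nlinarith [mul_le_mul_of_nonneg_left this (sq_nonneg π), mul_pos (pow_pos pi_pos 2) hz0]
  have hl''z2 : eigDeriv₂ γ z ≤ 12 * K * z ^ 2 := by
    have : 1 ≤ z ^ 2 := one_le_pow₀ hz1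
    simp only [eigDeriv₂, hK]
    nlinarith [mul_le_mul_of_nonneg_left this (sq_nonneg π)]
  have hpoly := abs_symbol_deriv₂_le hK0 hz0 hs (eig_pos hγ hz1) (eig_le hz1) hl'z hl'z2
    hl''z hl''z2
  set y := z ^ 4 * s with hy
  have hy0 : 0 < y := by positivity
  have hE : exp (-(eig γ z * s)) ≤ exp (-(α / 2 * y)) * exp (-(α / 2 * y)) := by
    rw [← exp_add, exp_le_exp]
    have := mul_le_mul_of_nonneg_right hlz1 hs.le
    simp only [hy]; linarith
  have hy1 := mul_exp_neg_le (y := y) hα0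
  have hy2 := sq_mul_exp_neg_le hα0 hy0
  have hE1 : exp (-(α / 2 * y)) ≤ 1 := exp_le_one_iff.2 (by simp only [neg_nonpos]; positivity)
  rw [abs_mul, abs_of_pos (exp_pos _)]
  set E := exp (-(α / 2 * y)) with hEdef
  have hEpos : 0 < E := exp_pos _
  calc _ ≤ z ^ 2 * (12 * K + 44 * K ^ 2 * y + 16 * K ^ 3 * y ^ 2) * (E * E) :=
        mul_le_mul hpoly hE (exp_pos _).le (by positivity)
    _ = z ^ 2 * (12 * K * E + 44 * K ^ 2 * (y * E) + 16 * K ^ 3 * (y ^ 2 * E)) * E := by ring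
    _ ≤ z ^ 2 * (12 * K * 1 + 44 * K ^ 2 * (2 / α) + 16 * K ^ 3 * (2 * (2 / α) ^ 2)) * E := by
        gcongr
    _ ≤ (3 * ξ) ^ 2 * (12 * K * 1 + 44 * K ^ 2 * (2 / α) + 16 * K ^ 3 * (2 * (2 / α) ^ 2)) *
        exp (-(α / 2 * ξ ^ 4 * s)) := by
        have h1 : z ≤ 3 * ξ := by linarith [hz.2]
        have h2 : E ≤ exp (-(α / 2 * ξ ^ 4 * s)) := by
          rw [hEdef, exp_le_exp, neg_le_neg_iff, hy, ← mul_assoc]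
          gcongr
          exact hz.1
        gcongr
    _ = _ := by ring

lemma hasSum_mul_second_difference {a : ℕ → ℝ} (ha : Tendsto a atTop (𝓝 0))
    (hs : Summable fun p : ℕ => ((p : ℝ) + 1) * |a (p + 2) - 2 * a (p + 1) + a p|) :
    HasSum (fun p : ℕ => ((p : ℝ) + 1) * (a (p + 2) - 2 * a (p + 1) + a p)) (a 0) := by
  set F : ℕ → ℝ := fun p => ((p : ℝ) + 1) * |a (p + 2) - 2 * a (p + 1) + a p| with hF
  have hdiff : ∀ N K : ℕ, ∑ i ∈ Finset.range K, (a (i + N + 2) - 2 * a (i + N + 1) + a (i + N)) =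
      (a (K + N + 1) - a (K + N)) - (a (N + 1) - a N) := by
    intro N K
    induction K with
    | zero => simp
    | succ K ih =>
      rw [Finset.sum_range_succ, ih, show K + 1 + N + 1 = K + N + 2 by ring,
        show K + 1 + N = K + N + 1 by ring]
      ring
  have hbound : ∀ N : ℕ, |(N : ℝ) * (a (N + 1) - a N)| ≤ ∑' i, F (i + N) := by
    intro N
    have hsN : Summable fun i => F (i + N) := (summable_nat_add_iff N).2 hs
    have hlim : Tendsto (fun K : ℕ => (N : ℝ) * ((a (K + N + 1) - a (K + N)) - (a (N + 1) - a N)))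
        atTop (𝓝 ((N : ℝ) * ((0 - 0) - (a (N + 1) - a N)))) := by
      have h1 : Tendsto (fun K : ℕ => a (K + N + 1)) atTop (𝓝 0) :=
        ha.comp ((tendsto_add_atTop_nat (N + 1)).congr fun _ => rfl)
      have h2 : Tendsto (fun K : ℕ => a (K + N)) atTop (𝓝 0) := ha.comp (tendsto_add_atTop_nat N)
      exact ((h1.sub h2).sub_const _).const_mul _
    have hle := le_of_tendsto' hlim.abs (b := ∑' i, F (i + N)) fun K => by
      rw [← hdiff, Finset.mul_sum]
      refine (Finset.abs_sum_le_sum_abs _ _).trans ?_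
      refine le_trans (Finset.sum_le_sum fun i _ => ?_) (hsN.sum_le_tsum (Finset.range K)
        fun i _ => by simp only [hF]; positivity)
      simp only [hF]
      rw [abs_mul, abs_of_nonneg (Nat.cast_nonneg N)]
      gcongr
      push_cast
      have : (0:ℝ) ≤ i := Nat.cast_nonneg i
      linarith
    rwa [show (N : ℝ) * (0 - 0 - (a (N + 1) - a N)) = -(N * (a (N + 1) - a N)) by ring,
      abs_neg] at hle
  have hN : Tendsto (fun N : ℕ => (N : ℝ) * (a (N + 1) - a N)) atTop (𝓝 0) :=
    squeeze_zero_norm hbound (tendsto_sum_nat_add F)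
  have hpart : ∀ N : ℕ, ∑ p ∈ Finset.range N, ((p : ℝ) + 1) * (a (p + 2) - 2 * a (p + 1) + a p) =
      a 0 - a N + N * (a (N + 1) - a N) := by
    intro N
    induction N with
    | zero => simp
    | succ N ih =>
      rw [Finset.sum_range_succ, ih, show N + 1 + 1 = N + 2 by ring]
      push_cast; ring
  have hsum : Summable fun p : ℕ => ((p : ℝ) + 1) * (a (p + 2) - 2 * a (p + 1) + a p) := by
    refine Summable.of_norm (hs.congr fun p => ?_)
    rw [hF, norm_mul, Real.norm_eq_abs, Real.norm_eq_abs,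
      abs_of_nonneg (by positivity : (0:ℝ) ≤ p + 1)]
  rw [hsum.hasSum_iff_tendsto_nat]
  simp_rw [hpart]
  simpa using (ha.const_sub (a 0)).add hN

lemma hasSum_sineCoeff {f : ℕ → ℝ → ℝ} {b : ℕ → ℝ} (hf : ∀ m, Continuous (f m)) (hb : Summable b)
    (hfb : ∀ m y, |f m y| ≤ b m) (n : ℕ) :
    HasSum (fun m => sineCoeff (f m) n) (sineCoeff (fun y => ∑' m, f m y) n) := by
  have key : HasSum (fun m => ∫ y in (0:ℝ)..1, f m y * sin (n * π * y))
      (∫ y in (0:ℝ)..1, (∑' m, f m y) * sin (n * π * y)) := by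
    refine intervalIntegral.hasSum_integral_of_dominated_convergence (fun m _ => b m)
      (fun m => ?_) (fun m => ?_) ?_ intervalIntegrable_const ?_
    · exact Continuous.aestronglyMeasurable (by have := hf m; fun_prop)
    · refine Filter.Eventually.of_forall fun y _ => ?_
      rw [norm_mul, Real.norm_eq_abs, Real.norm_eq_abs]
      exact (mul_le_of_le_one_right (abs_nonneg _) (abs_sin_le_one _)).trans (hfb m y)
    · exact Filter.Eventually.of_forall fun y _ => hb
    · refine Filter.Eventually.of_forall fun y _ => HasSum.mul_right _ ?_
      exact (Summable.of_norm_bounded hb fun m => hfb m y).hasSum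
  exact key.mul_left 2

lemma continuous_sineCoeff {F : ℝ → ℝ → ℝ} (hF : Continuous fun p : ℝ × ℝ => F p.1 p.2) (n : ℕ) :
    Continuous fun t => sineCoeff (F t) n := by
  simp only [sineCoeff]
  refine continuous_const.mul
    (intervalIntegral.continuous_parametric_intervalIntegral_of_continuous' ?_ 0 1)
  simp only [Function.uncurry_def]
  fun_prop

lemma continuous_lagDefect {a : ℝ} (ha : 0 < a) {h : ℝ → ℝ} (hc : Continuous h) {B : ℝ}
    (hB : ∀ t, |h t| ≤ B) : Continuous (lagDefect a h) := by
  have : Continuous (expConv a h) :=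
    continuous_iff_continuousAt.2 fun t => (hasDerivAt_expConv ha hc hB t).continuousAt
  exact (continuous_const.mul this).sub hc

lemma setIntegral_sub_two_mul_add {S : Set ℝ} {f g h : ℝ → ℝ}
    (hf : MeasureTheory.IntegrableOn f S) (hg : MeasureTheory.IntegrableOn g S)
    (hh : MeasureTheory.IntegrableOn h S) :
    MeasureTheory.IntegrableOn (fun s => f s - 2 * g s + h s) S ∧
    ∫ s in S, (f s - 2 * g s + h s) = (∫ s in S, f s) - 2 * (∫ s in S, g s) + ∫ s in S, h s := by
  have h2 := hg.const_mul 2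
  have h3 : MeasureTheory.IntegrableOn (fun s => f s - 2 * g s) S := hf.sub h2
  refine ⟨h3.add hh, ?_⟩
  rw [MeasureTheory.integral_add h3 hh, MeasureTheory.integral_sub hf h2,
    MeasureTheory.integral_const_mul]

lemma abs_lagDefect_le {a : ℝ} (ha : 0 < a) {h : ℝ → ℝ} (hc : Continuous h) {B : ℝ}
    (hB : ∀ t, |h t| ≤ B) {K θ : ℝ} (hθ : 0 < θ)
    (hh : ∀ t, ∀ s > 0, |h (t - s) - h t| ≤ K * s ^ θ) (t : ℝ) :
    |lagDefect a h t| ≤ K * Gamma (θ + 1) * a ^ (-θ) := by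
  obtain ⟨hi, he⟩ := integral_exp_mul_rpow ha hθ
  have hle : |lagDefect a h t| ≤ ∫ s in Ioi (0:ℝ), a * K * (exp (-(a * s)) * s ^ θ) := by
    rw [lagDefect_eq_integral ha hc hB, ← Real.norm_eq_abs]
    refine MeasureTheory.norm_integral_le_of_norm_le (hi.const_mul (a * K)) ?_
    filter_upwards [MeasureTheory.ae_restrict_mem measurableSet_Ioi] with s hs
    rw [norm_mul, norm_mul, Real.norm_eq_abs, Real.norm_eq_abs, Real.norm_eq_abs, abs_exp,
      abs_of_pos ha]
    calc a * exp (-(a * s)) * |h (t - s) - h t| ≤ a * exp (-(a * s)) * (K * s ^ θ) := by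
          gcongr; exact hh t s hs
      _ = _ := by ring
  rw [MeasureTheory.integral_const_mul, he] at hle
  refine hle.trans_eq ?_
  rw [show -θ = 1 + -(θ + 1) by ring, rpow_add ha, rpow_one]
  ring

/-- Second difference in the wave number of the heat symbol. -/
noncomputable def heatDiff (γ : ℝ) (m : ℕ) (s : ℝ) : ℝ :=
  heatSymbol γ s ((m:ℝ) + 1 + 2) - 2 * heatSymbol γ s ((m:ℝ) + 1 + 1) + heatSymbol γ s ((m:ℝ) + 1)

lemma exists_abs_integral_heatDiff_mul_le {γ θ : ℝ} (hγ : 0 < γ) (hθ : 0 < θ) :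
    ∃ D : ℝ, 0 ≤ D ∧ ∀ (m : ℕ) (K : ℝ) (g : ℝ → ℝ), (∀ s > 0, |g s| ≤ K * s ^ θ) →
      |∫ s in Ioi (0:ℝ), heatDiff γ m s * g s| ≤ K * (D * ((m:ℝ) + 1) ^ (-2 - 4 * θ)) := by
  obtain ⟨C, hC, c, hc, hb⟩ := exists_abs_second_difference_heatSymbol_le hγ
  refine ⟨C * Gamma (θ + 1) * c ^ (-(θ + 1)), ?_, ?_⟩
  · have := Gamma_pos_of_pos (show 0 < θ + 1 by linarith)
    positivity
  intro m K g hg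
  have hm : (1:ℝ) ≤ (m:ℝ) + 1 := by have : (0:ℝ) ≤ m := Nat.cast_nonneg m; linarith
  set ξ : ℝ := (m:ℝ) + 1 with hξ
  have hξ0 : 0 < ξ := by linarith
  obtain ⟨hi, he⟩ := integral_exp_mul_rpow (a := c * ξ ^ 4) (by positivity) hθ
  have hle : |∫ s in Ioi (0:ℝ), heatDiff γ m s * g s| ≤
      ∫ s in Ioi (0:ℝ), C * ξ ^ 2 * K * (exp (-(c * ξ ^ 4 * s)) * s ^ θ) := by
    rw [← Real.norm_eq_abs]
    refine MeasureTheory.norm_integral_le_of_norm_le (hi.const_mul _) ?_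
    filter_upwards [MeasureTheory.ae_restrict_mem measurableSet_Ioi] with s hs
    rw [norm_mul, Real.norm_eq_abs, Real.norm_eq_abs]
    calc |heatDiff γ m s| * |g s| ≤ (C * ξ ^ 2 * exp (-(c * ξ ^ 4 * s))) * (K * s ^ θ) := by
          gcongr
          · exact hb s hs ξ hm
          · exact hg s hs
      _ = _ := by ring
  rw [MeasureTheory.integral_const_mul, he] at hle
  refine hle.trans_eq ?_
  rw [mul_rpow hc.le (by positivity), ← rpow_natCast ξ 4, ← rpow_mul hξ0.le,
    show -2 - 4 * θ = (2:ℕ) + ((4:ℕ):ℝ) * -(θ + 1) by push_cast; ring, rpow_add hξ0, rpow_natCast]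
  ring

section Residual

variable (γ : ℝ) (F : ℝ → ℝ → ℝ)

/-- Lag defect of the `j`-th sine coefficient at the rate of the wave number `m + 1`. -/
noncomputable def lagCoeff (m j : ℕ) (t : ℝ) : ℝ :=
  lagDefect (eig γ ((m:ℝ) + 1)) (fun τ => sineCoeff (F τ) j) t

noncomputable def lagCoeffDiff (m j : ℕ) (t : ℝ) : ℝ :=
  lagCoeff γ F (m + 2) j t - 2 * lagCoeff γ F (m + 1) j t + lagCoeff γ F m j t

/-- Fejér-type resummation of the series `∑ λⱼuⱼ - φⱼ`. -/
noncomputable def residualTerm (m : ℕ) (t x : ℝ) : ℝ :=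
  ∑ j ∈ Finset.range (m + 2), (((m + 2 : ℕ) : ℝ) - j) * (lagCoeffDiff γ F m j t * sin (j * π * x))

noncomputable def fejerResidual (t x : ℝ) : ℝ := ∑' m : ℕ, residualTerm γ F m t x

end Residual

/-- Continuous bounded forcing, uniformly Hölder in time. -/
structure HolderForcing (F : ℝ → ℝ → ℝ) (M L θ : ℝ) : Prop where
  continuous : Continuous fun p : ℝ × ℝ => F p.1 p.2
  bound : ∀ t x, |F t x| ≤ M
  pos : 0 < θ
  holder : ∀ t s x, |F t x - F s x| ≤ L * |t - s| ^ θ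

namespace HolderForcing

variable {γ M L θ : ℝ} {F : ℝ → ℝ → ℝ}

lemma continuous_right (hF : HolderForcing F M L θ) (t : ℝ) : Continuous (F t) :=
  hF.continuous.comp (Continuous.prodMk_right t)

lemma abs_sub_le (hF : HolderForcing F M L θ) (t x : ℝ) {s : ℝ} (hs : 0 < s) :
    |F (t - s) x - F t x| ≤ L * s ^ θ := by
  have := hF.holder (t - s) t x
  rwa [show t - s - t = -s by ring, abs_neg, abs_of_pos hs] at this

lemma abs_sineCoeff_sub_le (hF : HolderForcing F M L θ) (n : ℕ) (t : ℝ) {s : ℝ} (hs : 0 < s) :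
    |sineCoeff (F (t - s)) n - sineCoeff (F t) n| ≤ 2 * L * s ^ θ := by
  rw [← sineCoeff_sub (hF.continuous_right _) (hF.continuous_right _)]
  exact (abs_sineCoeff_le (fun y => hF.abs_sub_le t y hs) n).trans_eq (by ring)

lemma lagCoeffDiff_eq (hF : HolderForcing F M L θ) (hγ : 0 < γ) (m j : ℕ) (t : ℝ) :
    MeasureTheory.IntegrableOn (fun s => heatDiff γ m s *
        (sineCoeff (F (t - s)) j - sineCoeff (F t) j)) (Ioi 0) ∧
    lagCoeffDiff γ F m j t = ∫ s in Ioi (0:ℝ), heatDiff γ m s *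
        (sineCoeff (F (t - s)) j - sineCoeff (F t) j) := by
  have hpos : ∀ k : ℕ, 0 < eig γ ((k:ℝ) + 1) := fun k =>
    eig_pos hγ (by have : (0:ℝ) ≤ k := Nat.cast_nonneg k; linarith)
  have hc := continuous_sineCoeff hF.continuous j
  have hB : ∀ t, |sineCoeff (F t) j| ≤ 2 * M := fun t => abs_sineCoeff_le (hF.bound t) j
  have I := fun k : ℕ => integrableOn_exp_mul_sub (hpos k) hc hB t
  have e : ∀ s, heatDiff γ m s * (sineCoeff (F (t - s)) j - sineCoeff (F t) j) =
      eig γ (((m + 2 : ℕ) : ℝ) + 1) * exp (-(eig γ (((m + 2 : ℕ) : ℝ) + 1) * s)) *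
        (sineCoeff (F (t - s)) j - sineCoeff (F t) j) -
      2 * (eig γ (((m + 1 : ℕ) : ℝ) + 1) * exp (-(eig γ (((m + 1 : ℕ) : ℝ) + 1) * s)) *
        (sineCoeff (F (t - s)) j - sineCoeff (F t) j)) +
      eig γ ((m : ℝ) + 1) * exp (-(eig γ ((m : ℝ) + 1) * s)) *
        (sineCoeff (F (t - s)) j - sineCoeff (F t) j) := by
    intro s
    rw [heatDiff, show (m:ℝ) + 1 + 2 = ((m + 2 : ℕ) : ℝ) + 1 by push_cast; ring,
      show (m:ℝ) + 1 + 1 = ((m + 1 : ℕ) : ℝ) + 1 by push_cast; ring]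
    simp only [heatSymbol]
    ring
  simp_rw [e]
  obtain ⟨h1, h2⟩ := setIntegral_sub_two_mul_add (I (m + 2)) (I (m + 1)) (I m)
  refine ⟨h1, ?_⟩
  rw [h2]
  simp only [lagCoeffDiff, lagCoeff]
  rw [lagDefect_eq_integral (hpos _) hc hB, lagDefect_eq_integral (hpos _) hc hB,
    lagDefect_eq_integral (hpos _) hc hB]

lemma exists_abs_lagCoeffDiff_le (hF : HolderForcing F M L θ) (hγ : 0 < γ) :
    ∃ D : ℝ, 0 ≤ D ∧ ∀ (m j : ℕ) (t : ℝ),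
      |lagCoeffDiff γ F m j t| ≤ 2 * L * (D * ((m:ℝ) + 1) ^ (-2 - 4 * θ)) := by
  obtain ⟨D, hD, h⟩ := exists_abs_integral_heatDiff_mul_le hγ hF.pos
  refine ⟨D, hD, fun m j t => ?_⟩
  rw [(hF.lagCoeffDiff_eq hγ m j t).2]
  exact h m _ _ fun s hs => hF.abs_sineCoeff_sub_le j t hs

lemma exists_abs_residualTerm_le (hF : HolderForcing F M L θ) (hγ : 0 < γ) :
    ∃ D : ℝ, 0 ≤ D ∧ ∀ (m : ℕ) (t x : ℝ),
      |residualTerm γ F m t x| ≤ ((m:ℝ) + 2) * L * (D * ((m:ℝ) + 1) ^ (-2 - 4 * θ)) := by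
  obtain ⟨D, hD, h⟩ := exists_abs_integral_heatDiff_mul_le hγ hF.pos
  refine ⟨D, hD, fun m t x => ?_⟩
  have e : residualTerm γ F m t x = ∫ s in Ioi (0:ℝ), heatDiff γ m s *
      ∑ j ∈ Finset.range (m + 2), (((m + 2 : ℕ) : ℝ) - j) *
        (sineCoeff (fun y => F (t - s) y - F t y) j * sin (j * π * x)) := by
    simp_rw [sineCoeff_sub (hF.continuous_right _) (hF.continuous_right _), Finset.mul_sum]
    rw [MeasureTheory.integral_finsetSum]
    · refine Finset.sum_congr rfl fun j _ => ?_
      rw [(hF.lagCoeffDiff_eq hγ m j t).2, ← MeasureTheory.integral_mul_const,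
        ← MeasureTheory.integral_const_mul]
      congr 1; ext s; ring
    · intro j _
      refine (((hF.lagCoeffDiff_eq hγ m j t).1.mul_const (sin (j * π * x))).const_mul
        (((m + 2 : ℕ) : ℝ) - j)).congr (Filter.Eventually.of_forall fun s => ?_)
      simp only; ring
  rw [e]
  refine h m _ _ fun s hs => ?_
  have := abs_fejer_sum_le (g := fun y => F (t - s) y - F t y)
    ((hF.continuous_right _).sub (hF.continuous_right _)) (fun y => hF.abs_sub_le t y hs) (m + 2) x
  refine this.trans_eq ?_
  push_cast; ring

lemma summable_rpow (hθ : 0 < θ) : Summable fun m : ℕ => ((m:ℝ) + 1) ^ (-1 - 4 * θ) := by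
  have := (summable_nat_add_iff 1).2 (Real.summable_nat_rpow (p := -1 - 4 * θ)|>.2 (by linarith))
  simpa using this

lemma exists_summable_bound_residualTerm (hF : HolderForcing F M L θ) (hγ : 0 < γ) :
    ∃ b : ℕ → ℝ, Summable b ∧ ∀ (m : ℕ) (t x : ℝ), |residualTerm γ F m t x| ≤ b m := by
  obtain ⟨D, hD, h⟩ := hF.exists_abs_residualTerm_le hγ
  refine ⟨fun m => 2 * L * D * ((m:ℝ) + 1) ^ (-1 - 4 * θ), (summable_rpow hF.pos).mul_left _,
    fun m t x => (h m t x).trans ?_⟩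
  have hL : 0 ≤ L := by simpa using (abs_nonneg _).trans (hF.holder 1 0 0)
  have hm : (0:ℝ) ≤ m := Nat.cast_nonneg m
  have hξ : (0:ℝ) < (m:ℝ) + 1 := by linarith
  beta_reduce
  rw [show -1 - 4 * θ = (1:ℝ) + (-2 - 4 * θ) by ring, rpow_add hξ, rpow_one]
  calc ((m:ℝ) + 2) * L * (D * ((m:ℝ) + 1) ^ (-2 - 4 * θ))
      ≤ (2 * ((m:ℝ) + 1)) * L * (D * ((m:ℝ) + 1) ^ (-2 - 4 * θ)) := by gcongr; linarith
    _ = _ := by ring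

lemma continuous_lagCoeff (hF : HolderForcing F M L θ) (hγ : 0 < γ) (m j : ℕ) :
    Continuous (lagCoeff γ F m j) :=
  continuous_lagDefect (eig_pos hγ (by have : (0:ℝ) ≤ m := Nat.cast_nonneg m; linarith))
    (continuous_sineCoeff hF.continuous j) fun t => abs_sineCoeff_le (hF.bound t) j

lemma continuous_residualTerm (hF : HolderForcing F M L θ) (hγ : 0 < γ) (m : ℕ) :
    Continuous fun p : ℝ × ℝ => residualTerm γ F m p.1 p.2 := by
  have h1 := fun k j => hF.continuous_lagCoeff hγ k j
  simp only [residualTerm, lagCoeffDiff]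
  fun_prop

lemma continuous_fejerResidual (hF : HolderForcing F M L θ) (hγ : 0 < γ) :
    Continuous fun p : ℝ × ℝ => fejerResidual γ F p.1 p.2 := by
  obtain ⟨b, hb, h⟩ := hF.exists_summable_bound_residualTerm hγ
  exact continuous_tsum (hF.continuous_residualTerm hγ) hb fun m p => h m p.1 p.2

lemma tendsto_lagCoeff (hF : HolderForcing F M L θ) (hγ : 0 < γ) (j : ℕ) (t : ℝ) :
    Tendsto (fun m => lagCoeff γ F m j t) atTop (𝓝 0) := by
  have hpos : ∀ k : ℕ, 0 < eig γ ((k:ℝ) + 1) := fun k =>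
    eig_pos hγ (by have : (0:ℝ) ≤ k := Nat.cast_nonneg k; linarith)
  refine squeeze_zero_norm (fun m => abs_lagDefect_le (hpos m) (continuous_sineCoeff hF.continuous j)
    (fun t => abs_sineCoeff_le (hF.bound t) j) hF.pos
    (fun t s hs => hF.abs_sineCoeff_sub_le j t hs) t) ?_
  have hE : Tendsto (fun m : ℕ => eig γ ((m:ℝ) + 1)) atTop atTop := by
    refine tendsto_atTop_mono (f := fun m : ℕ => γ * π ^ 4 * (m:ℝ)) (fun m => ?_)
      (tendsto_natCast_atTop_atTop.const_mul_atTop (by positivity))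
    have hm : (0:ℝ) ≤ m := Nat.cast_nonneg m
    refine le_trans ?_ (le_eig (γ := γ) (ξ := (m:ℝ) + 1) (by linarith))
    have : (m:ℝ) ≤ ((m:ℝ) + 1) ^ 4 := by nlinarith [pow_nonneg hm 2, pow_nonneg hm 3, pow_nonneg hm 4]
    gcongr
  simpa using ((tendsto_rpow_neg_atTop hF.pos).comp hE).const_mul (2 * L * Gamma (θ + 1))

lemma _root_.sineCoeff_residualTerm (m : ℕ) (t : ℝ) {n : ℕ} (hn : n ≠ 0) :
    sineCoeff (residualTerm γ F m t) n =
      if n < m + 2 then (((m + 2 : ℕ) : ℝ) - n) * lagCoeffDiff γ F m n t else 0 := by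
  have e : sineCoeff (residualTerm γ F m t) n = ∑ j ∈ Finset.range (m + 2),
      (((m + 2 : ℕ) : ℝ) - j) * (lagCoeffDiff γ F m j t * sineCoeff (fun y => sin (j * π * y)) n) := by
    simp only [sineCoeff, residualTerm, Finset.sum_mul]
    rw [intervalIntegral.integral_finsetSum
      fun j _ => Continuous.intervalIntegrable (by fun_prop) _ _, Finset.mul_sum]
    refine Finset.sum_congr rfl fun j _ => ?_
    simp only [mul_assoc, intervalIntegral.integral_const_mul]
    ring
  rw [e]
  simp_rw [sineCoeff_sin _ n hn]
  simp [Finset.sum_ite_eq', mul_ite]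

lemma hasSum_sineCoeff_residualTerm (hF : HolderForcing F M L θ) (hγ : 0 < γ) (t : ℝ) (n : ℕ) :
    HasSum (fun m => sineCoeff (residualTerm γ F m t) n) (sineCoeff (fejerResidual γ F t) n) := by
  obtain ⟨b, hb, h⟩ := hF.exists_summable_bound_residualTerm hγ
  exact hasSum_sineCoeff
    (fun m => (hF.continuous_residualTerm hγ m).comp (Continuous.prodMk_right t)) hb
    (fun m y => h m t y) n

lemma hasSum_lagCoeffDiff (hF : HolderForcing F M L θ) (hγ : 0 < γ) (t : ℝ) (k j : ℕ) :
    HasSum (fun p : ℕ => ((p:ℝ) + 1) * lagCoeffDiff γ F (p + k) j t) (lagCoeff γ F k j t) := by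
  have key := hasSum_mul_second_difference (a := fun p => lagCoeff γ F (p + k) j t)
    ((hF.tendsto_lagCoeff hγ j t).comp (tendsto_add_atTop_nat k))
  have e : ∀ p, lagCoeff γ F (p + 2 + k) j t - 2 * lagCoeff γ F (p + 1 + k) j t +
      lagCoeff γ F (p + k) j t = lagCoeffDiff γ F (p + k) j t := fun p => by
    rw [lagCoeffDiff, show p + k + 2 = p + 2 + k by ring, show p + k + 1 = p + 1 + k by ring]
  simp only [e, zero_add] at key
  refine key ?_
  obtain ⟨D, hD, hd⟩ := hF.exists_abs_lagCoeffDiff_le hγ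
  refine Summable.of_nonneg_of_le (fun p => by positivity) (fun p => ?_)
    (((summable_nat_add_iff k).2 (summable_rpow hF.pos)).mul_left (2 * L * D))
  have hk : (0:ℝ) ≤ k := Nat.cast_nonneg k
  have hξ : (0:ℝ) < ((p + k : ℕ) : ℝ) + 1 := by positivity
  calc _ ≤ (((p + k : ℕ) : ℝ) + 1) * (2 * L * (D * (((p + k : ℕ) : ℝ) + 1) ^ (-2 - 4 * θ))) := by
        gcongr
        · linarith
        · exact hd (p + k) j t
    _ = _ := by
        rw [show -1 - 4 * θ = (1:ℝ) + (-2 - 4 * θ) by ring, rpow_add hξ, rpow_one]; ring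

lemma sineCoeff_fejerResidual (hF : HolderForcing F M L θ) (hγ : 0 < γ) (t : ℝ) {n : ℕ}
    (hn : n ≠ 0) :
    sineCoeff (fejerResidual γ F t) n = lagDefect (eig γ n) (fun τ => sineCoeff (F τ) n) t := by
  obtain ⟨k, rfl⟩ : ∃ k, n = k + 1 := ⟨n - 1, by omega⟩
  have h1 := (hasSum_nat_add_iff' k).2 (hF.hasSum_sineCoeff_residualTerm hγ t (k + 1))
  have h0 : ∑ i ∈ Finset.range k, sineCoeff (residualTerm γ F i t) (k + 1) = 0 :=
    Finset.sum_eq_zero fun i hi => by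
      rw [sineCoeff_residualTerm _ t hn, if_neg]
      have := Finset.mem_range.1 hi
      omega
  rw [h0, sub_zero] at h1
  have h2 := hF.hasSum_lagCoeffDiff hγ t k (k + 1)
  have e : (fun p : ℕ => sineCoeff (residualTerm γ F (p + k) t) (k + 1)) =
      fun p : ℕ => ((p:ℝ) + 1) * lagCoeffDiff γ F (p + k) (k + 1) t := by
    ext p
    rw [sineCoeff_residualTerm _ t hn, if_pos (by omega)]
    push_cast; ring
  rw [e] at h1
  rw [h1.unique h2, lagCoeff, Nat.cast_add, Nat.cast_one]

end HolderForcing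

lemma integral_second_deriv_mul_sin {a b μ : ℝ} (hab : a ≤ b) {g g' g'' : ℝ → ℝ}
    (h1 : ∀ x ∈ Icc a b, HasDerivAt g (g' x) x) (h2 : ∀ x ∈ Icc a b, HasDerivAt g' (g'' x) x)
    (hc : ContinuousOn g'' (Icc a b)) (hμ : sin (μ * (b - a)) = 0) :
    ∫ x in a..b, g'' x * sin (μ * (x - a)) =
      -(μ * (g b * cos (μ * (b - a)) - g a)) - μ ^ 2 * ∫ x in a..b, g x * sin (μ * (x - a)) := by
  rw [← uIcc_of_le hab] at h1 h2 hc
  have hs : ∀ x, HasDerivAt (fun x => sin (μ * (x - a))) (μ * cos (μ * (x - a))) x := fun x => by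
    convert! (((hasDerivAt_id' x).sub_const a).const_mul μ).sin using 1
    ring
  have hcs : ∀ x, HasDerivAt (fun x => μ * cos (μ * (x - a))) (-(μ ^ 2 * sin (μ * (x - a)))) x :=
    fun x => by
    convert! ((((hasDerivAt_id' x).sub_const a).const_mul μ).cos).const_mul μ using 1
    ring
  have i1 : IntervalIntegrable g' MeasureTheory.volume a b :=
    ContinuousOn.intervalIntegrable fun x hx => (h2 x hx).continuousAt.continuousWithinAt
  have e1 := intervalIntegral.integral_mul_deriv_eq_deriv_mul (fun x _ => hs x) h2
    (Continuous.intervalIntegrable (by fun_prop) _ _) hc.intervalIntegrable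
  have e2 := intervalIntegral.integral_mul_deriv_eq_deriv_mul (fun x _ => hcs x) h1
    (Continuous.intervalIntegrable (by fun_prop) _ _) i1
  have e3 : ∀ x, g'' x * sin (μ * (x - a)) = sin (μ * (x - a)) * g'' x := fun x => mul_comm _ _
  simp_rw [e3]
  rw [e1, e2, hμ, sub_self, mul_zero, sin_zero, cos_zero]
  have e4 : ∀ x, -(μ ^ 2 * sin (μ * (x - a))) * g x = -μ ^ 2 * (g x * sin (μ * (x - a))) :=
    fun x => by ring
  simp_rw [e4, intervalIntegral.integral_const_mul]
  ring

/-- The solution of `w'' = g`, `w 0 = w 1 = 0`. -/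
noncomputable def dirichletPrimitive (g : ℝ → ℝ) (x : ℝ) : ℝ :=
  (∫ y in (0:ℝ)..x, ∫ z in (0:ℝ)..y, g z) - x * ∫ y in (0:ℝ)..1, ∫ z in (0:ℝ)..y, g z

lemma hasDerivAt_integral_right {g : ℝ → ℝ} (hg : Continuous g) (x : ℝ) :
    HasDerivAt (fun y => ∫ z in (0:ℝ)..y, g z) (g x) x :=
  (hg.integral_hasStrictDerivAt 0 x).hasDerivAt

lemma continuous_integral_right {g : ℝ → ℝ} (hg : Continuous g) :
    Continuous fun y => ∫ z in (0:ℝ)..y, g z :=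
  continuous_iff_continuousAt.2 fun x => (hasDerivAt_integral_right hg x).continuousAt

lemma hasDerivAt_dirichletPrimitive {g : ℝ → ℝ} (hg : Continuous g) (x : ℝ) :
    HasDerivAt (dirichletPrimitive g)
      ((∫ z in (0:ℝ)..x, g z) - ∫ y in (0:ℝ)..1, ∫ z in (0:ℝ)..y, g z) x := by
  have := (hasDerivAt_integral_right (continuous_integral_right hg) x).sub
    ((hasDerivAt_id x).mul_const (∫ y in (0:ℝ)..1, ∫ z in (0:ℝ)..y, g z))
  simpa using! this

lemma sineCoeff_dirichletPrimitive {g : ℝ → ℝ} (hg : Continuous g) {n : ℕ} :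
    sineCoeff g n = -(n * π) ^ 2 * sineCoeff (dirichletPrimitive g) n := by
  have := integral_second_deriv_mul_sin (a := 0) (b := 1) (μ := n * π) zero_le_one
    (fun x _ => hasDerivAt_dirichletPrimitive hg x)
    (fun x _ => (hasDerivAt_integral_right hg x).sub_const _) hg.continuousOn
    (by simp [sin_nat_mul_pi])
  simp only [sub_zero] at this
  rw [sineCoeff, this, sineCoeff]
  simp [dirichletPrimitive]
  ring

/-- Sine series with coefficients `c`. -/
noncomputable def sineSeries (c : ℕ → ℝ) (x : ℝ) : ℝ := ∑' n : ℕ, c n * sin (n * π * x)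

/-- Cosine series with coefficients `c`. -/
noncomputable def cosSeries (c : ℕ → ℝ) (x : ℝ) : ℝ := ∑' n : ℕ, c n * cos (n * π * x)

lemma abs_mul_sin_le (c z : ℝ) : |c * sin z| ≤ |c| := by
  rw [abs_mul]; exact mul_le_of_le_one_right (abs_nonneg _) (abs_sin_le_one _)

lemma abs_mul_cos_le (c z : ℝ) : |c * cos z| ≤ |c| := by
  rw [abs_mul]; exact mul_le_of_le_one_right (abs_nonneg _) (abs_cos_le_one _)

lemma hasDerivAt_sineSeries {c b : ℕ → ℝ} (hb : Summable b) (hc : ∀ n, |c n * (n * π)| ≤ b n)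
    (x : ℝ) : HasDerivAt (sineSeries c) (cosSeries (fun n => c n * (n * π)) x) x := by
  refine hasDerivAt_tsum (g := fun n x => c n * sin (n * π * x))
    (g' := fun n x => c n * (n * π) * cos (n * π * x)) (y₀ := 0) hb (fun n y => ?_)
    (fun n y => (abs_mul_cos_le _ _).trans (hc n)) (by simp) x
  convert! (((hasDerivAt_id' y).const_mul (n * π)).sin).const_mul (c n) using 1
  ring

lemma hasDerivAt_cosSeries {c b : ℕ → ℝ} (hb : Summable b) (hc0 : Summable c)
    (hc : ∀ n, |c n * (n * π)| ≤ b n) (x : ℝ) :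
    HasDerivAt (cosSeries c) (sineSeries (fun n => -(c n * (n * π))) x) x := by
  refine hasDerivAt_tsum (g := fun n x => c n * cos (n * π * x))
    (g' := fun n x => -(c n * (n * π)) * sin (n * π * x)) (y₀ := 0) hb (fun n y => ?_)
    (fun n y => (abs_mul_sin_le _ _).trans (by rw [abs_neg]; exact hc n)) (by simpa) x
  convert! (((hasDerivAt_id' y).const_mul (n * π)).cos).const_mul (c n) using 1
  ring

lemma continuous_sineSeries {X : Type*} [TopologicalSpace X] {c : X → ℕ → ℝ} {b : ℕ → ℝ}
    (hb : Summable b) (hc : ∀ t n, |c t n| ≤ b n) (hcc : ∀ n, Continuous fun t => c t n) :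
    Continuous fun p : X × ℝ => sineSeries (c p.1) p.2 :=
  continuous_tsum (fun n => by have := hcc n; fun_prop) hb
    fun n p => (abs_mul_sin_le _ _).trans (hc p.1 n)

lemma continuous_cosSeries {X : Type*} [TopologicalSpace X] {c : X → ℕ → ℝ} {b : ℕ → ℝ}
    (hb : Summable b) (hc : ∀ t n, |c t n| ≤ b n) (hcc : ∀ n, Continuous fun t => c t n) :
    Continuous fun p : X × ℝ => cosSeries (c p.1) p.2 :=
  continuous_tsum (fun n => by have := hcc n; fun_prop) hb
    fun n p => (abs_mul_cos_le _ _).trans (hc p.1 n)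

lemma sineCoeff_sineSeries {c b : ℕ → ℝ} (hb : Summable b) (hc : ∀ n, |c n| ≤ b n) {n : ℕ}
    (hn : n ≠ 0) : sineCoeff (sineSeries c) n = c n := by
  have h := hasSum_sineCoeff (f := fun m y => c m * sin (m * π * y)) (fun m => by fun_prop) hb
    (fun m y => (abs_mul_sin_le _ _).trans (hc m)) n
  simp_rw [sineCoeff_const_mul, sineCoeff_sin _ n hn] at h
  refine h.unique ?_
  convert hasSum_ite_eq n (c n) using 2 with m
  split_ifs with e <;> simp [e]

lemma sineSeries_zero (c : ℕ → ℝ) : sineSeries c 0 = 0 := by simp [sineSeries]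

lemma sineSeries_one (c : ℕ → ℝ) : sineSeries c 1 = 0 := by simp [sineSeries, sin_nat_mul_pi]

lemma sineCoeff_integral {R : ℝ → ℝ → ℝ} (hR : Continuous fun p : ℝ × ℝ => R p.1 p.2) (a b : ℝ)
    (n : ℕ) : sineCoeff (fun x => ∫ τ in a..b, R τ x) n = ∫ τ in a..b, sineCoeff (R τ) n := by
  simp only [sineCoeff]
  rw [intervalIntegral.integral_const_mul]
  congr 1
  simp_rw [← intervalIntegral.integral_mul_const]
  refine MeasureTheory.intervalIntegral_intervalIntegral_swap ?_
  have : Continuous (Function.uncurry fun x τ => R τ x * sin (n * π * x)) := by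
    simp only [Function.uncurry_def]; fun_prop
  exact (this.continuousOn.integrableOn_compact (isCompact_uIcc.prod isCompact_uIcc)).mono_set
    (prod_mono uIoc_subset_uIcc uIoc_subset_uIcc)

lemma continuous_slice_right {f : ℝ → ℝ → ℝ} (hf : Continuous fun p : ℝ × ℝ => f p.1 p.2) (t : ℝ) :
    Continuous (f t) := hf.comp (Continuous.prodMk_right t)

lemma continuous_slice_left {f : ℝ → ℝ → ℝ} (hf : Continuous fun p : ℝ × ℝ => f p.1 p.2) (x : ℝ) :
    Continuous fun t => f t x := hf.comp (Continuous.prodMk_left x)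

lemma continuous_integral_left {f : ℝ → ℝ → ℝ} (hf : Continuous fun p : ℝ × ℝ => f p.1 p.2)
    (a b : ℝ) : Continuous fun x => ∫ τ in a..b, f τ x :=
  intervalIntegral.continuous_parametric_intervalIntegral_of_continuous'
    (f := fun x τ => f τ x) (hf.comp continuous_swap) a b

/-- Sine coefficients of the periodic solution with forcing `F`. -/
noncomputable def mode (γ : ℝ) (F : ℝ → ℝ → ℝ) (t : ℝ) (n : ℕ) : ℝ :=
  expConv (eig γ n) (fun τ => sineCoeff (F τ) n) t

/-- The periodic solution with forcing `F`. -/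
noncomputable def efkSolution (γ : ℝ) (F : ℝ → ℝ → ℝ) (t : ℝ) : ℝ → ℝ := sineSeries (mode γ F t)

/-- The first spatial derivative of the periodic solution. -/
noncomputable def efkSolutionX (γ : ℝ) (F : ℝ → ℝ → ℝ) (t : ℝ) : ℝ → ℝ :=
  cosSeries fun n => mode γ F t n * (n * π)

/-- The second spatial derivative of the periodic solution. -/
noncomputable def efkSolutionXX (γ : ℝ) (F : ℝ → ℝ → ℝ) (t : ℝ) : ℝ → ℝ :=
  sineSeries fun n => -(mode γ F t n * (n * π) * (n * π))

/-- `γ` times the fourth spatial derivative of the periodic solution. -/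
noncomputable def efkTop (γ : ℝ) (F : ℝ → ℝ → ℝ) (t x : ℝ) : ℝ :=
  F t x + fejerResidual γ F t x + efkSolutionXX γ F t x + efkSolution γ F t x

/-- `γ` times the third spatial derivative of the periodic solution. -/
noncomputable def efkSolutionXXX (γ : ℝ) (F : ℝ → ℝ → ℝ) (t x : ℝ) : ℝ :=
  (∫ z in (0:ℝ)..x, efkTop γ F t z) - ∫ y in (0:ℝ)..1, ∫ z in (0:ℝ)..y, efkTop γ F t z

namespace HolderForcing

variable {γ M L θ ω : ℝ} {F : ℝ → ℝ → ℝ}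

lemma mode_zero (γ : ℝ) (F : ℝ → ℝ → ℝ) (t : ℝ) : mode γ F t 0 = 0 := by
  simp [mode, expConv, sineCoeff_zero]

lemma exists_abs_mode_le (hF : HolderForcing F M L θ) (hγ : 0 < γ) :
    ∃ b : ℕ → ℝ, Summable b ∧ (∀ t n, |mode γ F t n| ≤ b n) ∧
      (∀ t n, |mode γ F t n * (n * π)| ≤ b n) ∧
      ∀ t n, |mode γ F t n * (n * π) * (n * π)| ≤ b n := by
  have hM : 0 ≤ M := (abs_nonneg _).trans (hF.bound 0 0)
  have key : ∀ t (n : ℕ), n ≠ 0 →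
      |mode γ F t n * (n * π) * (n * π)| ≤ 2 * M / γ * ((n:ℝ) ^ 2)⁻¹ := by
    intro t n hn
    have hn1 : (1:ℝ) ≤ n := by exact_mod_cast Nat.one_le_iff_ne_zero.2 hn
    have h1 : |mode γ F t n| ≤ 2 * M / eig γ n := abs_expConv_le (eig_pos hγ hn1)
      (fun τ => abs_sineCoeff_le (hF.bound τ) n) t
    have h2 : 2 * M / eig γ n ≤ 2 * M / (γ * π ^ 4 * (n:ℝ) ^ 4) := by
      have := le_eig (γ := γ) hn1
      gcongr
    rw [mul_assoc, abs_mul, abs_of_nonneg (by positivity : (0:ℝ) ≤ n * π * (n * π))]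
    calc |mode γ F t n| * (n * π * (n * π))
        ≤ 2 * M / (γ * π ^ 4 * (n:ℝ) ^ 4) * (n * π * (n * π)) := by
          gcongr; exact h1.trans h2
      _ = 2 * M / γ * ((n:ℝ) ^ 2)⁻¹ * (π ^ 2)⁻¹ := by
          have : (n:ℝ) ≠ 0 := by positivity
          field_simp
      _ ≤ 2 * M / γ * ((n:ℝ) ^ 2)⁻¹ * 1 := by
          gcongr
          exact inv_le_one_of_one_le₀ one_lt_pi_sq.le
      _ = _ := mul_one _
  have hall : ∀ t n, |mode γ F t n * (n * π) * (n * π)| ≤ 2 * M / γ * ((n:ℝ) ^ 2)⁻¹ := by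
    intro t n
    rcases eq_or_ne n 0 with rfl | hn
    · simp
    · exact key t n hn
  have hmono : ∀ (c : ℝ) (n : ℕ), n ≠ 0 → |c| ≤ |c * (n * π)| := by
    intro c n hn
    have hn1 : (1:ℝ) ≤ n := by exact_mod_cast Nat.one_le_iff_ne_zero.2 hn
    rw [abs_mul, abs_of_nonneg (by positivity : (0:ℝ) ≤ n * π)]
    exact le_mul_of_one_le_right (abs_nonneg _)
      (one_le_mul_of_one_le_of_one_le hn1 (by linarith [pi_gt_three]))
  have hall1 : ∀ t n, |mode γ F t n * (n * π)| ≤ 2 * M / γ * ((n:ℝ) ^ 2)⁻¹ := by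
    intro t n
    rcases eq_or_ne n 0 with rfl | hn
    · simp
    · exact (hmono _ n hn).trans (hall t n)
  refine ⟨fun n => 2 * M / γ * ((n:ℝ) ^ 2)⁻¹,
    (Real.summable_nat_pow_inv.2 one_lt_two).mul_left _, fun t n => ?_, hall1, hall⟩
  rcases eq_or_ne n 0 with rfl | hn
  · simp [mode_zero]
  · exact (hmono _ n hn).trans (hall1 t n)

lemma hasDerivAt_mode (hF : HolderForcing F M L θ) (hγ : 0 < γ) {n : ℕ} (hn : n ≠ 0) (t : ℝ) :
    HasDerivAt (fun t => mode γ F t n)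
      (-lagDefect (eig γ n) (fun τ => sineCoeff (F τ) n) t) t := by
  have hn1 : (1:ℝ) ≤ n := by exact_mod_cast Nat.one_le_iff_ne_zero.2 hn
  refine (hasDerivAt_expConv (eig_pos hγ hn1) (continuous_sineCoeff hF.continuous n)
    (fun τ => abs_sineCoeff_le (hF.bound τ) n) t).congr_deriv ?_
  rw [lagDefect]; ring

lemma continuous_mode (hF : HolderForcing F M L θ) (hγ : 0 < γ) (n : ℕ) :
    Continuous fun t => mode γ F t n := by
  rcases eq_or_ne n 0 with rfl | hn
  · simp only [mode_zero]; exact continuous_const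
  · exact continuous_iff_continuousAt.2 fun t => (hF.hasDerivAt_mode hγ hn t).continuousAt

lemma continuous_efkSolution (hF : HolderForcing F M L θ) (hγ : 0 < γ) :
    Continuous fun p : ℝ × ℝ => efkSolution γ F p.1 p.2 := by
  obtain ⟨b, hb, h0, -, -⟩ := hF.exists_abs_mode_le hγ
  exact continuous_sineSeries hb h0 (hF.continuous_mode hγ)

lemma continuous_efkSolutionX (hF : HolderForcing F M L θ) (hγ : 0 < γ) :
    Continuous fun p : ℝ × ℝ => efkSolutionX γ F p.1 p.2 := by
  obtain ⟨b, hb, -, h1, -⟩ := hF.exists_abs_mode_le hγ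
  exact continuous_cosSeries hb h1 fun n => (hF.continuous_mode hγ n).mul continuous_const

lemma continuous_efkSolutionXX (hF : HolderForcing F M L θ) (hγ : 0 < γ) :
    Continuous fun p : ℝ × ℝ => efkSolutionXX γ F p.1 p.2 := by
  obtain ⟨b, hb, -, -, h2⟩ := hF.exists_abs_mode_le hγ
  exact continuous_sineSeries (c := fun t n => -(mode γ F t n * (n * π) * (n * π))) hb
    (fun t n => by rw [abs_neg]; exact h2 t n)
    fun n => (((hF.continuous_mode hγ n).mul continuous_const).mul continuous_const).neg

lemma continuous_efkTop (hF : HolderForcing F M L θ) (hγ : 0 < γ) :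
    Continuous fun p : ℝ × ℝ => efkTop γ F p.1 p.2 :=
  ((hF.continuous.add (hF.continuous_fejerResidual hγ)).add
    (hF.continuous_efkSolutionXX hγ)).add (hF.continuous_efkSolution hγ)

lemma hasDerivAt_efkSolution (hF : HolderForcing F M L θ) (hγ : 0 < γ) (t x : ℝ) :
    HasDerivAt (efkSolution γ F t) (efkSolutionX γ F t x) x := by
  obtain ⟨b, hb, -, h1, -⟩ := hF.exists_abs_mode_le hγ
  exact hasDerivAt_sineSeries hb (h1 t) x

lemma hasDerivAt_efkSolutionX (hF : HolderForcing F M L θ) (hγ : 0 < γ) (t x : ℝ) :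
    HasDerivAt (efkSolutionX γ F t) (efkSolutionXX γ F t x) x := by
  obtain ⟨b, hb, -, h1, h2⟩ := hF.exists_abs_mode_le hγ
  exact hasDerivAt_cosSeries hb (Summable.of_norm_bounded hb (h1 t)) (h2 t) x

lemma sineCoeff_efkSolution (hF : HolderForcing F M L θ) (hγ : 0 < γ) (t : ℝ) {n : ℕ}
    (hn : n ≠ 0) : sineCoeff (efkSolution γ F t) n = mode γ F t n := by
  obtain ⟨b, hb, h0, -, -⟩ := hF.exists_abs_mode_le hγ
  exact sineCoeff_sineSeries hb (h0 t) hn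

lemma sineCoeff_efkSolutionXX (hF : HolderForcing F M L θ) (hγ : 0 < γ) (t : ℝ) {n : ℕ}
    (hn : n ≠ 0) : sineCoeff (efkSolutionXX γ F t) n = -(mode γ F t n * (n * π) * (n * π)) := by
  obtain ⟨b, hb, -, -, h2⟩ := hF.exists_abs_mode_le hγ
  exact sineCoeff_sineSeries hb (fun n => by rw [abs_neg]; exact h2 t n) hn

lemma efkSolution_sub (hF : HolderForcing F M L θ) (hγ : 0 < γ) (t : ℝ) {x : ℝ}
    (hx : x ∈ Icc (0:ℝ) 1) :
    efkSolution γ F t x - efkSolution γ F 0 x = -∫ τ in (0:ℝ)..t, fejerResidual γ F τ x := by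
  have hR := hF.continuous_fejerResidual hγ
  have hu := hF.continuous_efkSolution hγ
  have hut : ∀ t, Continuous (efkSolution γ F t) := fun t => continuous_slice_right hu t
  have hG := continuous_integral_left hR 0 t
  have := eqOn_of_sineCoeff_eq (f := fun x => efkSolution γ F t x - efkSolution γ F 0 x)
    (g := fun x => -1 * ∫ τ in (0:ℝ)..t, fejerResidual γ F τ x)
    ((hut t).sub (hut 0)) (hG.const_mul (-1)) (fun n hn => by
    rw [sineCoeff_sub (hut t) (hut 0), sineCoeff_const_mul, sineCoeff_integral hR,
      hF.sineCoeff_efkSolution hγ _ hn, hF.sineCoeff_efkSolution hγ _ hn]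
    simp_rw [hF.sineCoeff_fejerResidual hγ _ hn]
    have hn1 : (1:ℝ) ≤ n := by exact_mod_cast Nat.one_le_iff_ne_zero.2 hn
    rw [neg_one_mul, ← intervalIntegral.integral_neg]
    refine (intervalIntegral.integral_eq_sub_of_hasDerivAt (fun s _ => hF.hasDerivAt_mode hγ hn s)
      (Continuous.intervalIntegrable ?_ _ _)).symm
    exact (continuous_lagDefect (eig_pos hγ hn1) (continuous_sineCoeff hF.continuous n)
      fun τ => abs_sineCoeff_le (hF.bound τ) n).neg) hx
  simpa only [neg_one_mul] using this

lemma hasDerivAt_efkSolution_time (hF : HolderForcing F M L θ) (hγ : 0 < γ) (t : ℝ) {x : ℝ}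
    (hx : x ∈ Icc (0:ℝ) 1) :
    HasDerivAt (fun t => efkSolution γ F t x) (-fejerResidual γ F t x) t := by
  have hR : Continuous fun τ => fejerResidual γ F τ x :=
    continuous_slice_left (hF.continuous_fejerResidual hγ) x
  have e : (fun t => efkSolution γ F t x) =
      fun t => efkSolution γ F 0 x + -∫ τ in (0:ℝ)..t, fejerResidual γ F τ x := by
    ext t; rw [← hF.efkSolution_sub hγ t hx]; ring
  rw [e]
  exact (hasDerivAt_integral_right hR t).neg.const_add _

lemma efkSolutionXX_eq (hF : HolderForcing F M L θ) (hγ : 0 < γ) (t : ℝ) :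
    EqOn (fun x => γ * efkSolutionXX γ F t x) (dirichletPrimitive (efkTop γ F t)) (Icc 0 1) := by
  have c0 := hF.continuous_right t
  have c1 : Continuous (fejerResidual γ F t) :=
    continuous_slice_right (hF.continuous_fejerResidual hγ) t
  have c2 : Continuous (efkSolutionXX γ F t) :=
    continuous_slice_right (hF.continuous_efkSolutionXX hγ) t
  have c3 : Continuous (efkSolution γ F t) :=
    continuous_slice_right (hF.continuous_efkSolution hγ) t
  have c4 : Continuous (efkTop γ F t) :=
    continuous_slice_right (hF.continuous_efkTop hγ) t
  have c01 : Continuous fun y => F t y + fejerResidual γ F t y := c0.add c1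
  have c02 : Continuous fun y => F t y + fejerResidual γ F t y + efkSolutionXX γ F t y :=
    c01.add c2
  have cd : Continuous (dirichletPrimitive (efkTop γ F t)) :=
    continuous_iff_continuousAt.2 fun x => (hasDerivAt_dirichletPrimitive c4 x).continuousAt
  refine eqOn_of_sineCoeff_eq (c2.const_mul γ) cd fun n hn => ?_
  have hnπ : (n:ℝ) * π ≠ 0 := mul_ne_zero (by exact_mod_cast hn) pi_ne_zero
  have h := sineCoeff_dirichletPrimitive c4 (n := n)
  have h' : sineCoeff (efkTop γ F t) n = sineCoeff (F t) n +
      lagDefect (eig γ n) (fun τ => sineCoeff (F τ) n) t +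
      -(mode γ F t n * (n * π) * (n * π)) + mode γ F t n := by
    rw [← hF.sineCoeff_fejerResidual hγ t hn, ← hF.sineCoeff_efkSolutionXX hγ t hn,
      ← hF.sineCoeff_efkSolution hγ t hn, ← sineCoeff_add c0 c1, ← sineCoeff_add c01 c2,
      ← sineCoeff_add c02 c3]
    rfl
  rw [h', lagDefect] at h
  have hm : expConv (eig γ n) (fun τ => sineCoeff (F τ) n) t = mode γ F t n := rfl
  rw [hm, eig] at h
  rw [sineCoeff_const_mul, hF.sineCoeff_efkSolutionXX hγ t hn]
  refine mul_left_cancel₀ (pow_ne_zero 2 hnπ) ?_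
  linear_combination -h

lemma efkSolution_periodic (hp : ∀ t x, F (t + ω) x = F t x) (t : ℝ) :
    efkSolution γ F (t + ω) = efkSolution γ F t := by
  have : mode γ F (t + ω) = mode γ F t := by
    ext n
    exact expConv_periodic (fun τ => by rw [show F (τ + ω) = F τ from funext (hp τ)]) t
  rw [efkSolution, this, efkSolution]

lemma continuous_efkSolutionXXX (hF : HolderForcing F M L θ) (hγ : 0 < γ) :
    Continuous fun p : ℝ × ℝ => efkSolutionXXX γ F p.1 p.2 := by
  have hT := hF.continuous_efkTop hγ
  have h1 : Continuous fun p : ℝ × ℝ => ∫ z in (0:ℝ)..p.2, efkTop γ F p.1 z :=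
    intervalIntegral.continuous_parametric_intervalIntegral_of_continuous
      (f := fun (p : ℝ × ℝ) z => efkTop γ F p.1 z)
      (hT.comp (continuous_fst.fst.prodMk continuous_snd)) continuous_snd
  have h2 : Continuous fun t : ℝ => ∫ y in (0:ℝ)..1, ∫ z in (0:ℝ)..y, efkTop γ F t z :=
    intervalIntegral.continuous_parametric_intervalIntegral_of_continuous'
      (f := fun t y => ∫ z in (0:ℝ)..y, efkTop γ F t z) h1 0 1
  exact h1.sub (h2.comp continuous_fst)

lemma hasDerivAt_efkSolutionXX (hF : HolderForcing F M L θ) (hγ : 0 < γ) (t : ℝ) {x : ℝ}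
    (hx : x ∈ Ioo (0:ℝ) 1) :
    HasDerivAt (efkSolutionXX γ F t) (γ⁻¹ * efkSolutionXXX γ F t x) x := by
  have hc := continuous_slice_right (hF.continuous_efkTop hγ) t
  refine ((hasDerivAt_dirichletPrimitive hc x).const_mul γ⁻¹).congr_of_eventuallyEq ?_
  filter_upwards [Ioo_mem_nhds hx.1 hx.2] with y hy
  rw [← hF.efkSolutionXX_eq hγ t (Ioo_subset_Icc_self hy), inv_mul_cancel_left₀ hγ.ne']

lemma hasDerivAt_efkSolutionXXX (hF : HolderForcing F M L θ) (hγ : 0 < γ) (t x : ℝ) :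
    HasDerivAt (efkSolutionXXX γ F t) (efkTop γ F t x) x :=
  (hasDerivAt_integral_right (continuous_slice_right (hF.continuous_efkTop hγ) t) x).sub_const _

lemma iteratedDeriv_two_efkSolution (hF : HolderForcing F M L θ) (hγ : 0 < γ) (t : ℝ) :
    iteratedDeriv 1 (efkSolution γ F t) = efkSolutionX γ F t ∧
    iteratedDeriv 2 (efkSolution γ F t) = efkSolutionXX γ F t := by
  have h1 : deriv (efkSolution γ F t) = efkSolutionX γ F t :=
    funext fun x => (hF.hasDerivAt_efkSolution hγ t x).deriv
  have h2 : deriv (efkSolutionX γ F t) = efkSolutionXX γ F t :=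
    funext fun x => (hF.hasDerivAt_efkSolutionX hγ t x).deriv
  exact ⟨by rw [iteratedDeriv_one, h1], by rw [iteratedDeriv_succ, iteratedDeriv_one, h1, h2]⟩

lemma hasDerivAt_iteratedDeriv_three_efkSolution (hF : HolderForcing F M L θ) (hγ : 0 < γ) (t : ℝ)
    {x : ℝ} (hx : x ∈ Ioo (0:ℝ) 1) :
    iteratedDeriv 3 (efkSolution γ F t) x = γ⁻¹ * efkSolutionXXX γ F t x ∧
    HasDerivAt (iteratedDeriv 3 (efkSolution γ F t)) (γ⁻¹ * efkTop γ F t x) x := by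
  have h3 : ∀ y ∈ Ioo (0:ℝ) 1,
      iteratedDeriv 3 (efkSolution γ F t) y = γ⁻¹ * efkSolutionXXX γ F t y := fun y hy => by
    rw [iteratedDeriv_succ, (hF.iteratedDeriv_two_efkSolution hγ t).2]
    exact (hF.hasDerivAt_efkSolutionXX hγ t hy).deriv
  refine ⟨h3 x hx, ((hF.hasDerivAt_efkSolutionXXX hγ t x).const_mul γ⁻¹).congr_of_eventuallyEq ?_⟩
  filter_upwards [Ioo_mem_nhds hx.1 hx.2] with y hy using h3 y hy

theorem isLinearPeriodicClassicalSolution (hF : HolderForcing F M L θ) (hγ : 0 < γ)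
    (hp : ∀ t x, F (t + ω) x = F t x) :
    IsLinearPeriodicClassicalSolution γ ω F (efkSolution γ F) := by
  have hu := hF.continuous_efkSolution hγ
  have hXX := hF.continuous_efkSolutionXX hγ
  have d4 : ∀ t, ∀ x ∈ Ioo (0:ℝ) 1, dx 4 (efkSolution γ F) t x = γ⁻¹ * efkTop γ F t x :=
    fun t x hx => by
      rw [dx, iteratedDeriv_succ]
      exact (hF.hasDerivAt_iteratedDeriv_three_efkSolution hγ t hx).2.deriv
  have d2 : ∀ t x, dx 2 (efkSolution γ F) t x = efkSolutionXX γ F t x := fun t x => by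
    rw [dx, (hF.iteratedDeriv_two_efkSolution hγ t).2]
  have dT : ∀ t, ∀ x ∈ Ioo (0:ℝ) 1, dt (efkSolution γ F) t x = -fejerResidual γ F t x :=
    fun t x hx => (hF.hasDerivAt_efkSolution_time hγ t (Ioo_subset_Icc_self hx)).deriv
  refine ⟨hu.continuousOn, fun t x => by rw [efkSolution_periodic hp], fun t x hx =>
    (hF.hasDerivAt_efkSolution_time hγ t (Ioo_subset_Icc_self hx)).differentiableAt,
    fun t x hx k hk => ?_, ?_, fun k hk => ?_, ?_, fun t x hx => ?_, fun t => ?_⟩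
  · interval_cases k
    · rw [iteratedDeriv_zero]; exact (hF.hasDerivAt_efkSolution hγ t x).differentiableAt
    · rw [(hF.iteratedDeriv_two_efkSolution hγ t).1]
      exact (hF.hasDerivAt_efkSolutionX hγ t x).differentiableAt
    · rw [(hF.iteratedDeriv_two_efkSolution hγ t).2]
      exact (hF.hasDerivAt_efkSolutionXX hγ t hx).differentiableAt
    · exact (hF.hasDerivAt_iteratedDeriv_three_efkSolution hγ t hx).2.differentiableAt
  · exact (hF.continuous_fejerResidual hγ).neg.continuousOn.congr fun p hp => dT p.1 p.2 hp.2
  · interval_cases k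
    · refine hu.continuousOn.congr fun p _ => ?_
      rw [dx, iteratedDeriv_zero]
    · refine (hF.continuous_efkSolutionX hγ).continuousOn.congr fun p _ => ?_
      rw [dx, (hF.iteratedDeriv_two_efkSolution hγ p.1).1]
    · exact hXX.continuousOn.congr fun p _ => d2 p.1 p.2
    · exact ((hF.continuous_efkSolutionXXX hγ).const_mul γ⁻¹).continuousOn.congr fun p hp =>
        (hF.hasDerivAt_iteratedDeriv_three_efkSolution hγ p.1 hp.2).1
    · exact ((hF.continuous_efkTop hγ).const_mul γ⁻¹).continuousOn.congr fun p hp =>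
        d4 p.1 p.2 hp.2
  · exact hXX.continuousOn.congr fun p _ => d2 p.1 p.2
  · rw [dT t x hx, d4 t x hx, d2, mul_inv_cancel_left₀ hγ.ne', efkTop]
    ring
  · rw [d2, d2]
    exact ⟨sineSeries_zero _, sineSeries_one _, sineSeries_zero _, sineSeries_one _⟩

end HolderForcing

lemma le_of_periodic_hasDerivAt {ω Λ D : ℝ} (hω : 0 < ω) (hΛ : 1 ≤ Λ) {A β : ℝ → ℝ}
    (hA : ∀ t, HasDerivAt A (-Λ * A t + β t) t) (hp : Function.Periodic A ω)
    (hβ : ∀ t, β t ≤ D) (hD : 0 ≤ D) (t : ℝ) : A t ≤ D := by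
  have hc : Continuous A := continuous_iff_continuousAt.2 fun t => (hA t).continuousAt
  obtain ⟨s, -, hs⟩ := isCompact_Icc.exists_isMaxOn (nonempty_Icc.2 hω.le)
    (hc.continuousOn (s := Icc 0 ω))
  have hmax : ∀ r, A r ≤ A s := fun r => by
    obtain ⟨r', hr', e⟩ := hp.exists_mem_Ico₀ hω r
    rw [e]
    exact hs (Ico_subset_Icc_self hr')
  have h0 : -Λ * A s + β s = 0 :=
    IsLocalMax.hasDerivAt_eq_zero (Filter.Eventually.of_forall hmax) (hA s)
  refine (hmax t).trans ?_
  by_contra! h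
  nlinarith [hβ s]

lemma abs_le_of_periodic_hasDerivAt {ω Λ D : ℝ} (hω : 0 < ω) (hΛ : 1 ≤ Λ) {A β : ℝ → ℝ}
    (hA : ∀ t, HasDerivAt A (-Λ * A t + β t) t) (hp : Function.Periodic A ω)
    (hβ : ∀ t, |β t| ≤ D) (t : ℝ) : |A t| ≤ D := by
  have hD : 0 ≤ D := (abs_nonneg _).trans (hβ 0)
  refine abs_le'.2 ⟨le_of_periodic_hasDerivAt hω hΛ hA hp (fun t => (le_abs_self _).trans (hβ t))
    hD t, ?_⟩
  refine le_of_periodic_hasDerivAt (A := fun t => -A t) (β := fun t => -β t) hω hΛ (fun t => ?_)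
    (fun t => congrArg Neg.neg (hp t)) (fun t => (neg_le_abs _).trans (hβ t)) hD t
  exact (hA t).neg.congr_deriv (by ring)

lemma exists_forall_abs_le_near_boundary {ω : ℝ} (hω : 0 < ω) {g : ℝ → ℝ → ℝ}
    (hg : ContinuousOn (fun p : ℝ × ℝ => g p.1 p.2) (univ ×ˢ Icc 0 1))
    (hp : ∀ t x, g (t + ω) x = g t x) (h0 : ∀ t, g t 0 = 0) (h1 : ∀ t, g t 1 = 0)
    {η : ℝ} (hη : 0 < η) :
    ∃ δ > 0, ∀ ε ∈ Ioo 0 δ, ∀ t, |g t ε| ≤ η ∧ |g t (1 - ε)| ≤ η := by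
  have huc := (isCompact_Icc.prod isCompact_Icc).uniformContinuousOn_of_continuous
    (hg.mono (prod_mono (subset_univ (Icc 0 ω)) Subset.rfl))
  obtain ⟨δ, hδ, h⟩ := Metric.uniformContinuousOn_iff.1 huc η hη
  refine ⟨min δ 1, lt_min hδ one_pos, fun ε hε t => ?_⟩
  have hε1 : ε < δ := hε.2.trans_le (min_le_left _ _)
  have hε2 : ε < 1 := hε.2.trans_le (min_le_right _ _)
  have hε0 := hε.1
  obtain ⟨s, hs, e⟩ := Function.Periodic.exists_mem_Ico₀ (f := g) (c := ω)
    (fun t => funext (hp t)) hω t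
  have hs' := Ico_subset_Icc_self hs
  rw [e]
  constructor
  · have := h (s, ε) ⟨hs', by constructor <;> simp only <;> linarith⟩ (s, 0) ⟨hs', by simp⟩
      (by simpa [Prod.dist_eq, Real.dist_eq, abs_of_pos hε0] using ⟨hδ, hε1⟩)
    simpa [h0, Real.dist_eq] using this.le
  · have := h (s, 1 - ε) ⟨hs', by constructor <;> simp only <;> linarith⟩ (s, 1) ⟨hs', by simp⟩
      (by simpa [Prod.dist_eq, Real.dist_eq, abs_of_pos hε0] using ⟨hδ, hε1⟩)
    simpa [h1, Real.dist_eq] using this.le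

lemma hasDerivAt_integral_mul {a b : ℝ} (hab : a ≤ b) {w w' : ℝ → ℝ → ℝ} {f : ℝ → ℝ}
    (hf : Continuous f) (hw : ∀ t, ContinuousOn (w t) (Icc a b))
    (hw' : ContinuousOn (fun p : ℝ × ℝ => w' p.1 p.2) (univ ×ˢ Icc a b))
    (hd : ∀ t, ∀ x ∈ Icc a b, HasDerivAt (fun s => w s x) (w' t x) t) (t : ℝ) :
    HasDerivAt (fun t => ∫ x in a..b, w t x * f x) (∫ x in a..b, w' t x * f x) t := by
  have hp : ContinuousOn (fun p : ℝ × ℝ => w' p.1 p.2 * f p.2) (univ ×ˢ Icc a b) :=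
    hw'.mul (hf.comp continuous_snd).continuousOn
  obtain ⟨C, hC⟩ := ((isCompact_Icc (a := t - 1) (b := t + 1)).prod
    isCompact_Icc).exists_bound_of_continuousOn (hp.mono (prod_mono (subset_univ _) Subset.rfl))
  have hcont : ∀ s, ContinuousOn (fun x => w s x * f x) (uIcc a b) := fun s => by
    rw [uIcc_of_le hab]; exact (hw s).mul hf.continuousOn
  have hcont' : ContinuousOn (fun x => w' t x * f x) (uIcc a b) := by
    rw [uIcc_of_le hab]
    exact hp.comp (Continuous.prodMk_right t).continuousOn fun x hx => ⟨mem_univ _, hx⟩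
  have hsub : uIoc a b ⊆ Icc a b := by rw [uIoc_of_le hab]; exact Ioc_subset_Icc_self
  refine (intervalIntegral.hasDerivAt_integral_of_dominated_loc_of_deriv_le
    (F := fun s x => w s x * f x) (F' := fun s x => w' s x * f x) (bound := fun _ => C)
    (s := Metric.ball t 1) (Metric.ball_mem_nhds t one_pos) ?_ ?_ ?_ ?_ ?_ ?_).2
  · exact Filter.Eventually.of_forall fun s =>
      (intervalIntegrable_iff.1 (hcont s).intervalIntegrable).aestronglyMeasurable
  · exact (hcont t).intervalIntegrable
  · exact (intervalIntegrable_iff.1 hcont'.intervalIntegrable).aestronglyMeasurable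
  · refine Filter.Eventually.of_forall fun x hx s hs => hC (s, x) ⟨?_, hsub hx⟩
    rw [Metric.mem_ball, Real.dist_eq, abs_lt] at hs
    constructor <;> simp only <;> linarith [hs.1, hs.2]
  · exact intervalIntegrable_const
  · exact Filter.Eventually.of_forall fun x hx s _ => (hd s x (hsub hx)).mul_const _

lemma tendsto_integral_mul_sin {g : ℝ → ℝ} (hg : ContinuousOn g (Icc 0 1)) (n : ℕ) :
    Tendsto (fun ε : ℝ => ∫ x in ε..1 - ε, g x * sin (n * π / (1 - 2 * ε) * (x - ε))) (𝓝[>] 0)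
      (𝓝 (∫ x in (0:ℝ)..1, g x * sin (n * π * x))) := by
  set G : ℝ → ℝ := IccExtend zero_le_one ((Icc (0:ℝ) 1).domRestrict g) with hG
  have hGc : Continuous G := (continuousOn_iff_continuous_domRestrict.1 hg).Icc_extend'
  have hGe : ∀ x ∈ Icc (0:ℝ) 1, G x = g x := fun x hx => IccExtend_of_mem _ _ hx
  have hc : Continuous fun ε : ℝ =>
      (1 - 2 * ε) * ∫ z in (0:ℝ)..1, G (ε + (1 - 2 * ε) * z) * sin (n * π * z) := by
    refine Continuous.mul (by fun_prop)
      (intervalIntegral.continuous_parametric_intervalIntegral_of_continuous' ?_ 0 1)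
    simp only [Function.uncurry_def]
    fun_prop
  have hlim := (hc.tendsto 0).mono_left (nhdsWithin_le_nhds (s := Ioi 0))
  have e0 : (1 - 2 * (0:ℝ)) * ∫ z in (0:ℝ)..1, G (0 + (1 - 2 * 0) * z) * sin (n * π * z) =
      ∫ x in (0:ℝ)..1, g x * sin (n * π * x) := by
    simp only [mul_zero, sub_zero, one_mul, zero_add]
    refine intervalIntegral.integral_congr fun x hx => ?_
    rw [uIcc_of_le zero_le_one] at hx
    simp only [hGe x hx]
  rw [e0] at hlim
  refine hlim.congr' ?_
  filter_upwards [Ioo_mem_nhdsGT (show (0:ℝ) < 1 / 2 by norm_num)] with ε hε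
  have hc0 : 1 - 2 * ε ≠ 0 := by linarith [hε.2]
  have e1 : ∀ z, G (ε + (1 - 2 * ε) * z) * sin (n * π * z) =
      G (ε + (1 - 2 * ε) * z) *
        sin (n * π / (1 - 2 * ε) * (ε + (1 - 2 * ε) * z - ε)) := fun z => by
    congr 2
    field_simp
    ring
  have e2 := intervalIntegral.mul_integral_comp_add_mul (a := 0) (b := 1) (c := 1 - 2 * ε)
    (d := ε) (f := fun x => G x * sin (n * π / (1 - 2 * ε) * (x - ε)))
  simp only [← e1] at e2
  rw [e2, mul_zero, add_zero, mul_one, show ε + (1 - 2 * ε) = 1 - ε by ring]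
  refine intervalIntegral.integral_congr fun x hx => ?_
  rw [uIcc_of_le (by linarith [hε.2])] at hx
  simp only [hGe x ⟨by linarith [hx.1, hε.1], by linarith [hx.2, hε.1]⟩]

lemma eq_zero_of_homogeneous_efk {γ ω : ℝ} (hγ : 0 < γ) (hω : 0 < ω)
    {w wt w₁ w₂ w₃ w₄ : ℝ → ℝ → ℝ}
    (hw : ContinuousOn (fun p : ℝ × ℝ => w p.1 p.2) (univ ×ˢ Icc 0 1))
    (hw₂ : ContinuousOn (fun p : ℝ × ℝ => w₂ p.1 p.2) (univ ×ˢ Icc 0 1))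
    (hwt : ContinuousOn (fun p : ℝ × ℝ => wt p.1 p.2) (univ ×ˢ Ioo 0 1))
    (hw₄ : ContinuousOn (fun p : ℝ × ℝ => w₄ p.1 p.2) (univ ×ˢ Ioo 0 1))
    (hp : ∀ t x, w (t + ω) x = w t x) (hp₂ : ∀ t x, w₂ (t + ω) x = w₂ t x)
    (hdt : ∀ t, ∀ x ∈ Ioo (0:ℝ) 1, HasDerivAt (fun s => w s x) (wt t x) t)
    (hd₁ : ∀ t, ∀ x ∈ Ioo (0:ℝ) 1, HasDerivAt (w t) (w₁ t x) x)
    (hd₂ : ∀ t, ∀ x ∈ Ioo (0:ℝ) 1, HasDerivAt (w₁ t) (w₂ t x) x)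
    (hd₃ : ∀ t, ∀ x ∈ Ioo (0:ℝ) 1, HasDerivAt (w₂ t) (w₃ t x) x)
    (hd₄ : ∀ t, ∀ x ∈ Ioo (0:ℝ) 1, HasDerivAt (w₃ t) (w₄ t x) x)
    (heq : ∀ t, ∀ x ∈ Ioo (0:ℝ) 1, wt t x + γ * w₄ t x - w₂ t x - w t x = 0)
    (h0 : ∀ t, w t 0 = 0) (h1 : ∀ t, w t 1 = 0) (h0₂ : ∀ t, w₂ t 0 = 0) (h1₂ : ∀ t, w₂ t 1 = 0)
    (t : ℝ) : ∀ x ∈ Icc (0:ℝ) 1, w t x = 0 := by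
  have hs : ∀ {g : ℝ → ℝ → ℝ} {I : Set ℝ},
      ContinuousOn (fun p : ℝ × ℝ => g p.1 p.2) (univ ×ˢ I) → ∀ s, ContinuousOn (g s) I :=
    fun hg s => hg.comp (Continuous.prodMk_right s).continuousOn fun x hx => ⟨mem_univ _, hx⟩
  refine eq_zero_of_integral_mul_sin_eq_zero (hs hw t) fun n => ?_
  rcases Nat.eq_zero_or_pos n with rfl | hn
  · simp
  have hn1 : (1:ℝ) ≤ n := by exact_mod_cast hn
  set N : ℝ := 2 * (n * π) with hN
  have hN0 : 0 < N := by positivity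
  set C : ℝ := γ * (2 * N) + (γ * N ^ 2 + 1) * (2 * N) with hC
  have hC0 : 0 < C := by positivity
  have key : ∀ η > 0, |∫ x in (0:ℝ)..1, w t x * sin (n * π * x)| ≤ C * η := by
    intro η hη
    obtain ⟨δ, hδ, hb⟩ := exists_forall_abs_le_near_boundary hω hw hp h0 h1 hη
    obtain ⟨δ₂, hδ₂, hb₂⟩ := exists_forall_abs_le_near_boundary hω hw₂ hp₂ h0₂ h1₂ hη
    refine le_of_tendsto (tendsto_integral_mul_sin (hs hw t) n).abs ?_
    filter_upwards [Ioo_mem_nhdsGT hδ, Ioo_mem_nhdsGT hδ₂,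
      Ioo_mem_nhdsGT (show (0:ℝ) < 1 / 4 by norm_num)] with ε hε hε₂ hε4
    have hab : ε ≤ 1 - ε := by linarith [hε4.2]
    have hsub : Icc ε (1 - ε) ⊆ Ioo (0:ℝ) 1 := fun x hx =>
      ⟨by linarith [hx.1, hε4.1], by linarith [hx.2, hε4.1]⟩
    have hsub' : Icc ε (1 - ε) ⊆ Icc (0:ℝ) 1 := hsub.trans Ioo_subset_Icc_self
    set μ : ℝ := n * π / (1 - 2 * ε) with hμ
    have hε0 : 0 < 1 - 2 * ε := by linarith [hε4.2]
    have hμab : μ * ((1 - ε) - ε) = n * π := by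
      rw [hμ]; field_simp; ring
    have hμsin : sin (μ * ((1 - ε) - ε)) = 0 := by rw [hμab, sin_nat_mul_pi]
    have hnπ : 1 ≤ n * π := by nlinarith [pi_gt_three]
    have hμ1 : 1 ≤ μ := by
      rw [hμ, le_div_iff₀ hε0]; linarith [hε4.1]
    have hμN : μ ≤ N := by
      rw [hμ, div_le_iff₀ hε0, hN]; nlinarith [hε4.2]
    set B : (ℝ → ℝ) → ℝ := fun g => μ * (g (1 - ε) * cos (μ * ((1 - ε) - ε)) - g ε) with hB
    have hBle : ∀ g : ℝ → ℝ, |g ε| ≤ η → |g (1 - ε)| ≤ η → |B g| ≤ 2 * N * η := by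
      intro g h h'
      have hcos : |g (1 - ε) * cos (μ * ((1 - ε) - ε))| ≤ η := by
        rw [abs_mul]
        exact (mul_le_of_le_one_right (abs_nonneg _) (abs_cos_le_one _)).trans h'
      have : |g (1 - ε) * cos (μ * ((1 - ε) - ε)) - g ε| ≤ 2 * η :=
        (abs_sub _ _).trans (by linarith)
      rw [hB]
      simp only
      rw [abs_mul, abs_of_pos (by linarith : 0 < μ)]
      calc μ * _ ≤ N * (2 * η) := by gcongr
        _ = _ := by ring
    have hwc : ∀ s, ContinuousOn (w s) (Icc ε (1 - ε)) := fun s => (hs hw s).mono hsub'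
    have hwc₂ : ∀ s, ContinuousOn (w₂ s) (Icc ε (1 - ε)) := fun s => (hs hw₂ s).mono hsub'
    have hwc₄ : ∀ s, ContinuousOn (w₄ s) (Icc ε (1 - ε)) := fun s => (hs hw₄ s).mono hsub
    have hsin : Continuous fun x => sin (μ * (x - ε)) := by fun_prop
    have hint : ∀ {g : ℝ → ℝ}, ContinuousOn g (Icc ε (1 - ε)) →
        IntervalIntegrable (fun x => g x * sin (μ * (x - ε))) MeasureTheory.volume ε (1 - ε) :=
      fun hg => ContinuousOn.intervalIntegrable (by
        rw [uIcc_of_le hab]; exact hg.mul hsin.continuousOn)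
    set A : ℝ → ℝ := fun s => ∫ x in ε..1 - ε, w s x * sin (μ * (x - ε)) with hA
    have hI₂ : ∀ s, ∫ x in ε..1 - ε, w₂ s x * sin (μ * (x - ε)) = -B (w s) - μ ^ 2 * A s :=
      fun s => integral_second_deriv_mul_sin hab (fun x hx => hd₁ s x (hsub hx))
        (fun x hx => hd₂ s x (hsub hx)) (hwc₂ s) hμsin
    have hI₄ : ∀ s, ∫ x in ε..1 - ε, w₄ s x * sin (μ * (x - ε)) =
        -B (w₂ s) - μ ^ 2 * (-B (w s) - μ ^ 2 * A s) := fun s => by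
      rw [← hI₂ s]
      exact integral_second_deriv_mul_sin hab (fun x hx => hd₃ s x (hsub hx))
        (fun x hx => hd₄ s x (hsub hx)) (hwc₄ s) hμsin
    have hA' : ∀ s, HasDerivAt A (-(γ * μ ^ 4 + μ ^ 2 - 1) * A s +
        (γ * B (w₂ s) - (γ * μ ^ 2 + 1) * B (w s))) s := fun s => by
      refine (hasDerivAt_integral_mul hab hsin hwc
        (hwt.mono (prod_mono Subset.rfl hsub))
        (fun s x hx => hdt s x (hsub hx)) s).congr_deriv ?_
      have e : ∫ x in ε..1 - ε, wt s x * sin (μ * (x - ε)) =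
          ∫ x in ε..1 - ε, (w₂ s x * sin (μ * (x - ε)) + w s x * sin (μ * (x - ε)) -
            γ * (w₄ s x * sin (μ * (x - ε)))) := by
        refine intervalIntegral.integral_congr fun x hx => ?_
        rw [uIcc_of_le hab] at hx
        linear_combination sin (μ * (x - ε)) * heq s x (hsub hx)
      rw [e, intervalIntegral.integral_sub ((hint (hwc₂ s)).add (hint (hwc s)))
        ((hint (hwc₄ s)).const_mul γ), intervalIntegral.integral_add (hint (hwc₂ s)) (hint (hwc s)),
        intervalIntegral.integral_const_mul, hI₂, hI₄]
      ring
    have hΛ : 1 ≤ γ * μ ^ 4 + μ ^ 2 - 1 := by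
      have h3 : 2 ≤ μ := by
        rw [hμ, le_div_iff₀ hε0]; nlinarith [hε4.1, pi_gt_three]
      have : 0 ≤ γ * μ ^ 4 := by positivity
      nlinarith
    refine abs_le_of_periodic_hasDerivAt hω hΛ hA' (fun s => by simp only [hA, hp]) (fun s => ?_) t
    have hw' := hBle (w s) (hb ε hε s).1 (hb ε hε s).2
    have hw₂' := hBle (w₂ s) (hb₂ ε hε₂ s).1 (hb₂ ε hε₂ s).2
    have hμ2 : γ * μ ^ 2 + 1 ≤ γ * N ^ 2 + 1 := by gcongr
    calc |γ * B (w₂ s) - (γ * μ ^ 2 + 1) * B (w s)|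
        ≤ |γ * B (w₂ s)| + |(γ * μ ^ 2 + 1) * B (w s)| := abs_sub _ _
      _ = γ * |B (w₂ s)| + (γ * μ ^ 2 + 1) * |B (w s)| := by
        rw [abs_mul γ, abs_mul (γ * μ ^ 2 + 1), abs_of_pos hγ,
          abs_of_pos (by positivity : 0 < γ * μ ^ 2 + 1)]
      _ ≤ γ * (2 * N * η) + (γ * N ^ 2 + 1) * (2 * N * η) := by gcongr
      _ = C * η := by rw [hC]; ring
  refine abs_nonpos_iff.1 (le_of_forall_pos_le_add fun ρ hρ => ?_)
  have := key (ρ / C) (by positivity)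
  rwa [mul_div_cancel₀ _ hC0.ne', ← zero_add ρ] at this

lemma IsLinearPeriodicClassicalSolution.hasDerivAt_dx {γ ω : ℝ} {φ u : ℝ → ℝ → ℝ}
    (hu : IsLinearPeriodicClassicalSolution γ ω φ u) (t : ℝ) {x : ℝ} (hx : x ∈ Ioo (0:ℝ) 1)
    {k : ℕ} (hk : k < 4) : HasDerivAt (dx k u t) (dx (k + 1) u t x) x := by
  obtain ⟨-, -, -, h, -⟩ := hu
  have := (h t x hx k hk).hasDerivAt
  rwa [← iteratedDeriv_succ] at this

lemma IsLinearPeriodicClassicalSolution.dx_add_period {γ ω : ℝ} {φ u : ℝ → ℝ → ℝ}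
    (hu : IsLinearPeriodicClassicalSolution γ ω φ u) (k : ℕ) (t x : ℝ) :
    dx k u (t + ω) x = dx k u t x := by
  simp only [dx, show u (t + ω) = u t from funext (hu.2.1 t)]

lemma IsLinearPeriodicClassicalSolution.eqOn {γ ω : ℝ} (hγ : 0 < γ) (hω : 0 < ω)
    {φ u v : ℝ → ℝ → ℝ} (hu : IsLinearPeriodicClassicalSolution γ ω φ u)
    (hv : IsLinearPeriodicClassicalSolution γ ω φ v) (t : ℝ) :
    EqOn (v t) (u t) (Icc 0 1) := by
  have hdx : ∀ k < 4, ∀ t, ∀ x ∈ Ioo (0:ℝ) 1, HasDerivAt (fun x => dx k v t x - dx k u t x)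
      (dx (k + 1) v t x - dx (k + 1) u t x) x := fun k hk t x hx =>
    (hv.hasDerivAt_dx t hx hk).sub (hu.hasDerivAt_dx t hx hk)
  have hpu := hu.dx_add_period
  have hpv := hv.dx_add_period
  obtain ⟨u1, u2, u3, -, u5, u6, u7, u8, u9⟩ := hu
  obtain ⟨v1, v2, v3, -, v5, v6, v7, v8, v9⟩ := hv
  have h0 : ∀ z : ℝ → ℝ → ℝ, ∀ t x, dx 0 z t x = z t x := fun z t x => by simp [dx]
  intro x hx
  refine sub_eq_zero.1 (eq_zero_of_homogeneous_efk hγ hω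
    (w := fun t x => v t x - u t x) (wt := fun t x => dt v t x - dt u t x)
    (w₁ := fun t x => dx 1 v t x - dx 1 u t x) (w₂ := fun t x => dx 2 v t x - dx 2 u t x)
    (w₃ := fun t x => dx 3 v t x - dx 3 u t x) (w₄ := fun t x => dx 4 v t x - dx 4 u t x)
    (v1.sub u1) (v7.sub u7) (v5.sub u5) ((v6 4 le_rfl).sub (u6 4 le_rfl))
    (fun t x => by simp only [u2, v2]) (fun t x => by simp only [hpu, hpv])
    (fun t x hx => (v3 t x hx).hasDerivAt.sub (u3 t x hx).hasDerivAt)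
    (fun t x hx => by simpa only [h0] using hdx 0 (by norm_num) t x hx)
    (hdx 1 (by norm_num)) (hdx 2 (by norm_num)) (hdx 3 (by norm_num))
    (fun t x hx => by linear_combination v8 t x hx - u8 t x hx)
    (fun t => by simp [u9, v9]) (fun t => by simp [u9, v9])
    (fun t => by simp [u9, v9]) (fun t => by simp [u9, v9]) t x hx)

lemma HolderForcing.of_holder_periodic {F : ℝ → ℝ → ℝ} {L θ ω : ℝ} (hω : 0 < ω) (hL : 0 ≤ L)
    (hθ : 0 < θ) (hF : ∀ t x s y, |F t x - F s y| ≤ L * (|t - s| + |x - y|) ^ θ)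
    (hp : ∀ t x, F (t + ω) x = F t x) {K : ℝ} (hK : ∀ x, |F 0 x| ≤ K) :
    HolderForcing F (K + L * ω ^ θ) L θ where
  continuous := by
    rw [continuous_iff_continuousAt]
    rintro ⟨s, y⟩
    rw [ContinuousAt, tendsto_iff_dist_tendsto_zero]
    have hc : Continuous fun p : ℝ × ℝ => L * (|p.1 - s| + |p.2 - y|) ^ θ :=
      continuous_const.mul
        ((by fun_prop : Continuous fun p : ℝ × ℝ => |p.1 - s| + |p.2 - y|).rpow_const
        fun _ => Or.inr hθ.le)
    have hlim := hc.tendsto (s, y)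
    simp only [sub_self, abs_zero, add_zero, Real.zero_rpow hθ.ne', mul_zero] at hlim
    exact squeeze_zero (fun _ => dist_nonneg) (fun p => by
      rw [Real.dist_eq]; exact hF p.1 p.2 s y) hlim
  bound t x := by
    obtain ⟨s, hs, e⟩ := Function.Periodic.exists_mem_Ico₀ (f := F) (c := ω)
      (fun t => funext (hp t)) hω t
    rw [e]
    have h1 := hF s x 0 x
    rw [sub_self, abs_zero, add_zero, sub_zero, abs_of_nonneg hs.1] at h1
    have h2 : s ^ θ ≤ ω ^ θ := Real.rpow_le_rpow hs.1 hs.2.le hθ.le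
    have h3 := abs_sub_abs_le_abs_sub (F s x) (F 0 x)
    have h4 : L * s ^ θ ≤ L * ω ^ θ := by gcongr
    linarith [hK x]
  pos := hθ
  holder t s x := by simpa using hF t x s x

/-- The linear extended Fisher–Kolmogorov equation with Hölder continuous,
time `ω`-periodic right-hand side has exactly one time `ω`-periodic classical
solution. -/
theorem linear_efk_periodic_classical_solution_exists_unique
    (γ ω : ℝ) (hγ : 0 < γ) (hω : 0 < ω)
    (φ : ℝ → ℝ → ℝ)
    (hφ : ∃ L > (0:ℝ), ∃ θ : ℝ, 0 < θ ∧ θ ≤ 1 ∧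
      ∀ t : ℝ, ∀ x ∈ Icc (0:ℝ) 1, ∀ s : ℝ, ∀ y ∈ Icc (0:ℝ) 1,
        |φ t x - φ s y| ≤ L * (|t - s| + |x - y|) ^ θ)
    (hφper : ∀ t : ℝ, ∀ x ∈ Icc (0:ℝ) 1, φ (t + ω) x = φ t x) :
    ∃ u : ℝ → ℝ → ℝ, IsLinearPeriodicClassicalSolution γ ω φ u ∧
      ∀ v : ℝ → ℝ → ℝ, IsLinearPeriodicClassicalSolution γ ω φ v →
        ∀ t : ℝ, ∀ x ∈ Icc (0:ℝ) 1, v t x = u t x := by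
  obtain ⟨L, hL, θ, hθ, -, hH⟩ := hφ
  set P : ℝ → ℝ := fun x => projIcc (0:ℝ) 1 zero_le_one x with hP
  have hPmem : ∀ x, P x ∈ Icc (0:ℝ) 1 := fun x => (projIcc (0:ℝ) 1 zero_le_one x).2
  have hPid : ∀ x ∈ Icc (0:ℝ) 1, P x = x := fun x hx => by rw [hP]; simp [projIcc_of_mem _ hx]
  have hPabs : ∀ x y, |P x - P y| ≤ |x - y| := fun x y => abs_projIcc_sub_projIcc zero_le_one
  have hF : ∀ t x s y, |φ t (P x) - φ s (P y)| ≤ L * (|t - s| + |x - y|) ^ θ := fun t x s y => by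
    refine (hH t _ (hPmem x) s _ (hPmem y)).trans ?_
    have := hPabs x y
    gcongr
  have hper : ∀ t x, φ (t + ω) (P x) = φ t (P x) := fun t x => hφper t _ (hPmem x)
  have hK : ∀ x, |φ 0 (P x)| ≤ |φ 0 0| + L := fun x => by
    have h1 := hH 0 _ (hPmem x) 0 0 (by simp)
    rw [sub_self, abs_zero, zero_add, sub_zero, abs_of_nonneg (hPmem x).1] at h1
    have h2 : P x ^ θ ≤ 1 := Real.rpow_le_one (hPmem x).1 (hPmem x).2 hθ.le
    have h3 := abs_sub_abs_le_abs_sub (φ 0 (P x)) (φ 0 0)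
    nlinarith
  have hsol := (HolderForcing.of_holder_periodic (F := fun t x => φ t (P x)) hω hL.le hθ hF hper
    hK).isLinearPeriodicClassicalSolution hγ hper
  have hsol' : IsLinearPeriodicClassicalSolution γ ω φ (efkSolution γ fun t x => φ t (P x)) := by
    obtain ⟨h1, h2, h3, h4, h5, h6, h7, h8, h9⟩ := hsol
    refine ⟨h1, h2, h3, h4, h5, h6, h7, fun t x hx => ?_, h9⟩
    rw [h8 t x hx]
    simp only [hPid x (Ioo_subset_Icc_self hx)]
  exact ⟨_, hsol', fun v hv t x hx => hsol'.eqOn hγ hω hv t hx⟩
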